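/- Let k ≥ ℓ ≥ 3, let s^(q)_n(k,ℓ) denote the number of (k,ℓ)-quadrocrucial permutations of length n, and let n satisfy k+2ℓ−5 ≤ n < (k−1)(ℓ−1). Then s^(q)_n(k,ℓ) < s^(q)_{n+1}(k,ℓ). Moreover, for every n and k, ℓ ≥ 3 there exist natural numbers m₁, …, m_t such that s^(q)_n(k,ℓ) = m₁² + ⋯ + m_t², where t is the number of partitions of n into exactly ℓ−1 parts whose largest part equals k−1. -/

import Mathlib

/-- `σ` (in one-line notation, 0-based) has an increasing subsequence of length `k`,
i.e. contains an occurrence of the pattern `i_k`. -/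
def HasIncr (k n : ℕ) (σ : Fin n → Fin n) : Prop :=
  ∃ f : Fin k → Fin n, StrictMono f ∧ StrictMono (σ ∘ f)

/-- `σ` has a decreasing subsequence of length `l`,
i.e. contains an occurrence of the pattern `d_l`. -/
def HasDecr (l n : ℕ) (σ : Fin n → Fin n) : Prop :=
  ∃ f : Fin l → Fin n, StrictMono f ∧ StrictAnti (σ ∘ f)

/-- `σ` contains `i_k` or `d_l`. -/
def ContainsPat (k l n : ℕ) (σ : Fin n → Fin n) : Prop :=
  HasIncr k n σ ∨ HasDecr l n σ

/-- `σ` avoids both `i_k` and `d_l`. -/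
def AvoidsPat (k l n : ℕ) (σ : Fin n → Fin n) : Prop :=
  ¬ HasIncr k n σ ∧ ¬ HasDecr l n σ

/-- The `i`-th extension of `σ` to the right (0-based): append the value `i` at the end,
renaming old values via `Fin.succAbove i` (i.e. `x ↦ x` if `x < i`, `x ↦ x+1` if `x ≥ i`). -/
def rightExt {n : ℕ} (σ : Fin n → Fin n) (i : Fin (n + 1)) : Fin (n + 1) → Fin (n + 1) :=
  Fin.snoc (fun j => i.succAbove (σ j)) i

/-- The `i`-th extension of `σ` to the left: prepend the value `i`. -/
def leftExt {n : ℕ} (σ : Fin n → Fin n) (i : Fin (n + 1)) : Fin (n + 1) → Fin (n + 1) :=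
  Fin.cons i (fun j => i.succAbove (σ j))

/-- The `i`-th extension of `σ` from above: insert the new maximum value at position `i`. -/
def topExt {n : ℕ} (σ : Fin n → Fin n) (i : Fin (n + 1)) : Fin (n + 1) → Fin (n + 1) :=
  i.insertNth (Fin.last n) (fun j => (σ j).castSucc)

/-- The `i`-th extension of `σ` from below: insert the new minimum value at position `i`,
increasing all old values by one. -/
def botExt {n : ℕ} (σ : Fin n → Fin n) (i : Fin (n + 1)) : Fin (n + 1) → Fin (n + 1) :=
  i.insertNth 0 (fun j => (σ j).succ)

/-- `σ` is `(k,l)`-right-crucial (also called `(k,l)`-crucial): it avoids `i_k` and `d_l`,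
but every extension of it to the right contains `i_k` or `d_l`. -/
def RightCrucial (k l n : ℕ) (σ : Fin n → Fin n) : Prop :=
  AvoidsPat k l n σ ∧ ∀ i : Fin (n + 1), ContainsPat k l (n + 1) (rightExt σ i)

/-- `σ` is `(k,l)`-left-crucial. -/
def LeftCrucial (k l n : ℕ) (σ : Fin n → Fin n) : Prop :=
  AvoidsPat k l n σ ∧ ∀ i : Fin (n + 1), ContainsPat k l (n + 1) (leftExt σ i)

/-- `σ` is `(k,l)`-top-crucial. -/
def TopCrucial (k l n : ℕ) (σ : Fin n → Fin n) : Prop :=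
  AvoidsPat k l n σ ∧ ∀ i : Fin (n + 1), ContainsPat k l (n + 1) (topExt σ i)

/-- `σ` is `(k,l)`-bottom-crucial. -/
def BottomCrucial (k l n : ℕ) (σ : Fin n → Fin n) : Prop :=
  AvoidsPat k l n σ ∧ ∀ i : Fin (n + 1), ContainsPat k l (n + 1) (botExt σ i)

/-- `σ` is `(k,l)`-bicrucial: both right-crucial and left-crucial. -/
def Bicrucial (k l n : ℕ) (σ : Fin n → Fin n) : Prop :=
  RightCrucial k l n σ ∧ LeftCrucial k l n σ

/-- `σ` is `(k,l)`-top-right-crucial: right-crucial and every extension from above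
contains `i_k` or `d_l`. -/
def TopRightCrucial (k l n : ℕ) (σ : Fin n → Fin n) : Prop :=
  RightCrucial k l n σ ∧ ∀ i : Fin (n + 1), ContainsPat k l (n + 1) (topExt σ i)

/-- `σ` is `(k,l)`-tricrucial: bicrucial and every extension from above
contains `i_k` or `d_l`. -/
def Tricrucial (k l n : ℕ) (σ : Fin n → Fin n) : Prop :=
  Bicrucial k l n σ ∧ ∀ i : Fin (n + 1), ContainsPat k l (n + 1) (topExt σ i)

/-- `σ` is `(k,l)`-quadrocrucial: tricrucial and every extension from below
contains `i_k` or `d_l`. -/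
def Quadrocrucial (k l n : ℕ) (σ : Fin n → Fin n) : Prop :=
  Tricrucial k l n σ ∧ ∀ i : Fin (n + 1), ContainsPat k l (n + 1) (botExt σ i)

namespace QC

/-- `w` has a subsequence of length `p` on which `R` holds pairwise. -/
def Ch (R : ℕ → ℕ → Prop) (p : ℕ) (w : List ℕ) : Prop :=
  ∃ s : List ℕ, s.Sublist w ∧ s.Pairwise R ∧ s.length = p

theorem Ch.mono {R : ℕ → ℕ → Prop} {p : ℕ} {u v : List ℕ} (h : Ch R p u) (huv : u.Sublist v) :
    Ch R p v := by
  obtain ⟨s, h1, h2, h3⟩ := h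
  exact ⟨s, h1.trans huv, h2, h3⟩

theorem Ch.le {R : ℕ → ℕ → Prop} {p q : ℕ} {u : List ℕ} (h : Ch R p u) (hq : q ≤ p) :
    Ch R q u := by
  obtain ⟨s, h1, h2, h3⟩ := h
  exact ⟨s.take q, (List.take_sublist _ _).trans h1, h2.sublist (List.take_sublist _ _), by
    simp; omega⟩

theorem ch_replace {R : ℕ → ℕ → Prop} {u v : List ℕ}
    (h : ∀ m : List ℕ, m.Sublist u → m.Pairwise R → ∃ m' : List ℕ, m'.Sublist v ∧ m'.Pairwise R ∧
      m'.length = m.length ∧ (∀ a, (∀ b ∈ m, R a b) → ∀ b ∈ m', R a b) ∧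
      (∀ a, (∀ b ∈ m, R b a) → ∀ b ∈ m', R b a)) (s t : List ℕ) (p : ℕ) :
    Ch R p (s ++ u ++ t) → Ch R p (s ++ v ++ t) := by
  rintro ⟨w, h1, h2, h3⟩
  obtain ⟨w1, w2, rfl, hw1, hw2⟩ := List.sublist_append_iff.1 h1
  obtain ⟨w3, w4, rfl, hw3, hw4⟩ := List.sublist_append_iff.1 hw1
  rw [List.pairwise_append, List.pairwise_append] at h2
  obtain ⟨⟨h5, h6, h7⟩, h8, h9⟩ := h2
  obtain ⟨m', g1, g2, g3, g4, g5⟩ := h w4 hw4 h6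
  refine ⟨w3 ++ m' ++ w2, (hw3.append g1).append hw2, ?_, ?_⟩
  · rw [List.pairwise_append, List.pairwise_append]
    refine ⟨⟨h5, g2, fun a ha b hb => g4 a (fun b hb => h7 a ha b hb) b hb⟩, h8, ?_⟩
    intro a ha b hb
    rcases List.mem_append.1 ha with ha | ha
    · exact h9 a (List.mem_append_left _ ha) b hb
    · exact g5 b (fun c hc => h9 c (List.mem_append_right _ hc) b hb) a ha
  · simp at h3 ⊢; omega

def Eqv (u v : List ℕ) : Prop :=
  ∀ (s t : List ℕ) (p : ℕ), (Ch (· < ·) p (s ++ u ++ t) ↔ Ch (· < ·) p (s ++ v ++ t)) ∧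
    (Ch (· > ·) p (s ++ u ++ t) ↔ Ch (· > ·) p (s ++ v ++ t))

theorem Eqv.refl (u : List ℕ) : Eqv u u := fun _ _ _ => ⟨Iff.rfl, Iff.rfl⟩
theorem Eqv.symm {u v : List ℕ} (h : Eqv u v) : Eqv v u :=
  fun s t p => ⟨(h s t p).1.symm, (h s t p).2.symm⟩
theorem Eqv.trans {u v w : List ℕ} (h : Eqv u v) (h' : Eqv v w) : Eqv u w :=
  fun s t p => ⟨(h s t p).1.trans (h' s t p).1, (h s t p).2.trans (h' s t p).2⟩
theorem Eqv.ctx {u v : List ℕ} (h : Eqv u v) (a b : List ℕ) : Eqv (a ++ u ++ b) (a ++ v ++ b) := by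
  intro s t p
  have := h (s ++ a) (b ++ t) p
  simpa [List.append_assoc] using this
theorem Eqv.left {u v : List ℕ} (h : Eqv u v) (a : List ℕ) : Eqv (a ++ u) (a ++ v) := by
  simpa using h.ctx a []
theorem Eqv.right {u v : List ℕ} (h : Eqv u v) (a : List ℕ) : Eqv (u ++ a) (v ++ a) := by
  simpa using h.ctx [] a
theorem Eqv.cons {u v : List ℕ} (h : Eqv u v) (a : ℕ) : Eqv (a :: u) (a :: v) := by
  simpa using h.ctx [a] []

theorem sub3 {a b c : ℕ} {m : List ℕ} (h : m.Sublist [a, b, c]) :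
    m = [] ∨ m = [a] ∨ m = [b] ∨ m = [c] ∨ m = [a, b] ∨ m = [a, c] ∨ m = [b, c] ∨
      m = [a, b, c] := by
  have := List.mem_sublists.2 h
  simp [List.sublists] at this
  tauto

theorem sub_self {R : ℕ → ℕ → Prop} {v : List ℕ} (m : List ℕ) (h : m.Sublist v)
    (h2 : m.Pairwise R) : ∃ m' : List ℕ, m'.Sublist v ∧ m'.Pairwise R ∧
      m'.length = m.length ∧ (∀ a, (∀ b ∈ m, R a b) → ∀ b ∈ m', R a b) ∧
      (∀ a, (∀ b ∈ m, R b a) → ∀ b ∈ m', R b a) :=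
  ⟨m, h, h2, rfl, fun _ h => h, fun _ h => h⟩

theorem s0 (a b c : ℕ) : ([] : List ℕ).Sublist [a,b,c] := by simp
theorem s1 (a b c : ℕ) : [a].Sublist [a,b,c] := by simp
theorem s2 (a b c : ℕ) : [b].Sublist [a,b,c] := by simp
theorem s3 (a b c : ℕ) : [c].Sublist [a,b,c] := by simp
theorem s12 (a b c : ℕ) : [a,b].Sublist [a,b,c] := by simp
theorem s13 (a b c : ℕ) : [a,c].Sublist [a,b,c] := by simp
theorem s23 (a b c : ℕ) : [b,c].Sublist [a,b,c] := by
  exact List.sublist_cons_self a [b,c]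

theorem knuth1 {x y z : ℕ} (hxy : x < y) (hyz : y < z) : Eqv [y, x, z] [y, z, x] := by
  intro s t p
  refine ⟨⟨ch_replace ?_ s t p, ch_replace ?_ s t p⟩,
    ⟨ch_replace ?_ s t p, ch_replace ?_ s t p⟩⟩
  all_goals
    intro m hm hp
    rcases sub3 hm with rfl | rfl | rfl | rfl | rfl | rfl | rfl | rfl
    all_goals first
      | exact sub_self _ (s0 _ _ _) hp
      | exact sub_self _ (s1 _ _ _) hp
      | exact sub_self _ (s2 _ _ _) hp
      | exact sub_self _ (s3 _ _ _) hp
      | exact sub_self _ (s12 _ _ _) hp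
      | exact sub_self _ (s13 _ _ _) hp
      | exact sub_self _ (s23 _ _ _) hp
      | (exfalso; simp at hp; omega)
      | (refine ⟨[y, z], s12 _ _ _, by simp; omega, rfl, ?_, ?_⟩ <;>
          (intro a ha; simp at ha ⊢; omega))
      | (refine ⟨[y, x], s12 _ _ _, by simp; omega, rfl, ?_, ?_⟩ <;>
          (intro a ha; simp at ha ⊢; omega))

theorem knuth2 {x y z : ℕ} (hxy : x < y) (hyz : y < z) : Eqv [x, z, y] [z, x, y] := by
  intro s t p
  refine ⟨⟨ch_replace ?_ s t p, ch_replace ?_ s t p⟩,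
    ⟨ch_replace ?_ s t p, ch_replace ?_ s t p⟩⟩
  all_goals
    intro m hm hp
    rcases sub3 hm with rfl | rfl | rfl | rfl | rfl | rfl | rfl | rfl
    all_goals first
      | exact sub_self _ (s0 _ _ _) hp
      | exact sub_self _ (s1 _ _ _) hp
      | exact sub_self _ (s2 _ _ _) hp
      | exact sub_self _ (s3 _ _ _) hp
      | exact sub_self _ (s12 _ _ _) hp
      | exact sub_self _ (s13 _ _ _) hp
      | exact sub_self _ (s23 _ _ _) hp
      | (exfalso; simp at hp; omega)
      | (refine ⟨[x, y], s23 _ _ _, by simp; omega, rfl, ?_, ?_⟩ <;>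
          (intro a ha; simp at ha ⊢; omega))
      | (refine ⟨[z, y], s23 _ _ _, by simp; omega, rfl, ?_, ?_⟩ <;>
          (intro a ha; simp at ha ⊢; omega))

theorem moveB {y : ℕ} : ∀ (B : List ℕ) (c : ℕ), y < c → (c :: B).Pairwise (· < ·) →
    Eqv (c :: (B ++ [y])) (c :: y :: B)
  | [], c, _, _ => Eqv.refl _
  | b :: B, c, hc, hp => by
    have hcb : c < b := (List.pairwise_cons.1 hp).1 b (by simp)
    have h1 := (moveB B b (hc.trans hcb) (List.pairwise_cons.1 hp).2).cons c
    have h2 := (knuth1 hc hcb).symm.right B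
    exact h1.trans h2

theorem moveA {y z : ℕ} (hyz : y < z) (B : List ℕ) : ∀ (A : List ℕ), A.Pairwise (· < ·) →
    (∀ a ∈ A, a < y) → Eqv (A ++ z :: y :: B) (z :: (A ++ y :: B))
  | [], _, _ => Eqv.refl _
  | [a], _, h => (knuth2 (h a (by simp)) hyz).right B
  | a :: a' :: A, hp, h => by
    have h1 := (moveA hyz B (a' :: A) (List.pairwise_cons.1 hp).2
      (fun b hb => h b (List.mem_cons_of_mem _ hb))).cons a
    have h2 : a < a' := (List.pairwise_cons.1 hp).1 a' (by simp)
    have h3 : a' < z := (h a' (by simp)).trans hyz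
    exact h1.trans ((knuth2 h2 h3).right (A ++ y :: B))

theorem row_knuth {y z : ℕ} (A B : List ℕ) (hyz : y < z) (hp : (A ++ z :: B).Pairwise (· < ·))
    (hA : ∀ a ∈ A, a < y) : Eqv ((A ++ z :: B) ++ [y]) (z :: (A ++ y :: B)) := by
  have h := List.pairwise_append.1 hp
  have h1 := (moveB B z hyz h.2.1).left A
  have h2 := moveA hyz B A h.1 hA
  have := h1.trans h2
  simpa using this

end QC
namespace QC

/-- The local growth rule. -/
def Cell (x : Prop) (v h v' h' : ℕ) : Prop :=
  (v = h ∧ (v ≠ 0 ∨ x) ∧ v' = v + 1 ∧ h' = h + 1) ∨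
    (¬ (v = h ∧ (v ≠ 0 ∨ x)) ∧ v' = v ∧ h' = h)

def row0 (n : ℕ) (V : ℕ → ℕ) (r : ℕ) : List ℕ := (List.range n).filter (fun j => V j = r)

def row (n : ℕ) (V : ℕ → ℕ) (r : ℕ) : List ℕ := (row0 n V r).map (fun j => 2 * j + 1)

def RA (n : ℕ) (V : ℕ → ℕ) : ℕ → ℕ → List ℕ
  | _, 0 => []
  | r, d + 1 => RA n V (r + 1) d ++ row n V r

theorem row0_sorted (n : ℕ) (V : ℕ → ℕ) (r : ℕ) : (row0 n V r).Pairwise (· < ·) :=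
  List.Pairwise.filter _ List.pairwise_lt_range

theorem mem_row0 {n : ℕ} {V : ℕ → ℕ} {r j : ℕ} : j ∈ row0 n V r ↔ j < n ∧ V j = r := by
  simp [row0]

theorem sorted_ext {L L' : List ℕ} (h : L.Pairwise (· < ·)) (h' : L'.Pairwise (· < ·))
    (hm : ∀ j, j ∈ L ↔ j ∈ L') : L = L' := by
  have n1 : L.Nodup := h.imp (fun h => Nat.ne_of_lt h)
  have n2 : L'.Nodup := h'.imp (fun h => Nat.ne_of_lt h)
  have := (List.perm_ext_iff_of_nodup n1 n2).2 hm
  exact this.eq_of_pairwise (fun a b _ _ h1 h2 => absurd (h1.trans h2) (lt_irrefl _)) h h'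

section col
variable {n : ℕ} {x : ℕ → Prop} {V V' H : ℕ → ℕ}

theorem H_mono (hc : ∀ j < n, Cell (x j) (V j) (H j) (V' j) (H (j + 1))) :
    ∀ {a b : ℕ}, a ≤ b → b ≤ n → H a ≤ H b := by
  intro a b hab hb
  induction b, hab using Nat.le_induction with
  | base => exact le_rfl
  | succ b hab ih =>
    have := ih (by omega)
    have h2 := hc b (by omega)
    unfold Cell at h2
    omega

set_option maxHeartbeats 1000000 in
theorem row_step (hc : ∀ j < n, Cell (x j) (V j) (H j) (V' j) (H (j + 1))) {r y z : ℕ}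
    (hr : 1 ≤ r) (hy : y < n) (hy1 : H y = r - 1) (hy2 : H (y + 1) = r)
    (hz : z < n) (hz1 : H z = r) (hz2 : H (z + 1) = r + 1) :
    Eqv (row n V r ++ [2 * y + 1]) ((2 * z + 1) :: row n V' r) := by
  have hyz : y < z := by
    by_contra h
    have := H_mono hc (show z ≤ y by omega) (by omega)
    omega
  have cy := hc y hy
  have cz := hc z hz
  have hVz : V z = r := by unfold Cell at cz; omega
  obtain ⟨A, B, hAB⟩ := List.append_of_mem (mem_row0.2 ⟨hz, hVz⟩)
  have hs := row0_sorted n V r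
  rw [hAB] at hs
  have hs' := List.pairwise_append.1 hs
  have hmem : ∀ j, (j < n ∧ V j = r) ↔ (j ∈ A ∨ j = z ∨ j ∈ B) := by
    intro j
    rw [← mem_row0, hAB]
    simp
  have hAz : ∀ a ∈ A, a < z := fun a ha => hs'.2.2 a ha z (by simp)
  have hBz : ∀ b ∈ B, z < b := fun b hb => (List.pairwise_cons.1 hs'.2.1).1 b hb
  have hAy : ∀ a ∈ A, a < y := by
    intro a ha
    have haz := hAz a ha
    have haV := (hmem a).2 (Or.inl ha)
    by_contra hay
    have c := hc a haV.1
    rcases Nat.eq_or_lt_of_le (not_lt.1 hay) with h | h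
    · subst h; unfold Cell at c cy; omega
    · have m1 := H_mono hc (show y + 1 ≤ a by omega) (by omega)
      have m2 := H_mono hc (show a ≤ z by omega) (by omega)
      have m3 := H_mono hc (show a + 1 ≤ z by omega) (by omega)
      unfold Cell at c; omega
  have hL' : row0 n V' r = A ++ y :: B := by
    apply sorted_ext (row0_sorted n V' r)
    · rw [List.pairwise_append]
      refine ⟨hs'.1, ?_, ?_⟩
      · rw [List.pairwise_cons]
        exact ⟨fun b hb => hyz.trans (hBz b hb), (List.pairwise_cons.1 hs'.2.1).2⟩
      · intro a ha b hb
        rcases List.mem_cons.1 hb with rfl | hb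
        · exact hAy a ha
        · exact hs'.2.2 a ha b (List.mem_cons_of_mem _ hb)
    · intro j
      rw [mem_row0]
      have hm := hmem j
      have e : j ∈ A ++ y :: B ↔ (j ∈ A ∨ j = y ∨ j ∈ B) := by simp
      rw [e]
      have hA1 := hAz j
      have hB1 := hBz j
      rcases lt_trichotomy j y with h | h | h
      · have hjn : j < n := by omega
        have c := hc j hjn
        have m1 := H_mono hc (show j + 1 ≤ y by omega) (by omega)
        have m2 := H_mono hc (show j ≤ y by omega) (by omega)
        have : V' j = r ↔ V j = r := by unfold Cell at c; omega
        rw [this, hm]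
        have n1 : j ≠ y := by omega
        have n2 : j ≠ z := by omega
        simp only [n1, n2]
      · subst h
        have : V' j = r := by unfold Cell at cy; omega
        simp [this, hy]
      · have hne : j ≠ y := by omega
        rcases lt_trichotomy j z with h' | h' | h'
        · have c := hc j (by omega)
          have m1 := H_mono hc (show y + 1 ≤ j by omega) (by omega)
          have m2 := H_mono hc (show j + 1 ≤ z by omega) (by omega)
          have m3 := H_mono hc (show j ≤ j + 1 by omega) (by omega)
          have : V' j = r ↔ V j = r := by unfold Cell at c; omega
          rw [this, hm]
          have n2 : j ≠ z := by omega
          simp only [hne, n2]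
        · subst h'
          have h1 : V' j ≠ r := by unfold Cell at cz; omega
          have h2 : j ∉ A := fun h => by have := hA1 h; omega
          have h3 : j ∉ B := fun h => by have := hB1 h; omega
          simp only [h1, h2, h3, hne, and_false, or_false]
        · have hne' : j ≠ z := by omega
          by_cases hjn : j < n
          · have c := hc j (by omega)
            have m1 := H_mono hc (show z + 1 ≤ j by omega) (by omega)
            have : V' j = r ↔ V j = r := by unfold Cell at c; omega
            rw [this, hm]
            simp only [hne, hne']
          · have h2 : j ∉ A := fun h => hjn (hm.2 (Or.inl h)).1
            have h3 : j ∉ B := fun h => hjn (hm.2 (Or.inr (Or.inr h))).1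
            simp only [hjn, h2, h3, hne, false_and, or_false]
  unfold row
  rw [hL', hAB]
  simp only [List.map_append, List.map_cons]
  apply row_knuth
  · omega
  · have : ((A ++ z :: B).map (fun j => 2 * j + 1)).Pairwise (· < ·) := by
      rw [List.pairwise_map]
      exact hs.imp (fun h => by omega)
    simpa using this
  · intro a ha
    obtain ⟨b, hb, rfl⟩ := List.mem_map.1 ha
    have := hAy b hb
    omega

theorem RA_congr {V V' : ℕ → ℕ} : ∀ (d r : ℕ), (∀ j < n, ∀ r' ≥ r, (V j = r' ↔ V' j = r')) →
    RA n V r d = RA n V' r d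
  | 0, _, _ => rfl
  | d + 1, r, h => by
    unfold RA
    rw [RA_congr d (r + 1) (fun j hj r' hr' => h j hj r' (by omega))]
    congr 1
    unfold row row0
    congr 1
    apply List.filter_congr
    intro j hj
    have := h j (List.mem_range.1 hj) r le_rfl
    simpa using this

theorem col_knuth (hc : ∀ j < n, Cell (x j) (V j) (H j) (V' j) (H (j + 1))) :
    ∀ (d r y : ℕ), 1 ≤ r → y < n → H y = r - 1 → H (y + 1) = r → (∀ j < n, V' j < r + d) →
      Eqv (RA n V r d ++ [2 * y + 1]) (RA n V' r d) := by
  intro d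
  induction d with
  | zero =>
    intro r y hr hy h1 h2 h3
    have c := hc y hy
    have := h3 y hy
    unfold Cell at c
    omega
  | succ d ih =>
    intro r y hr hy h1 h2 h3
    by_cases hz : ∃ z, z < n ∧ H z = r ∧ H (z + 1) = r + 1
    · obtain ⟨z, hz, hz1, hz2⟩ := hz
      have e1 := (row_step hc hr hy h1 h2 hz hz1 hz2).left (RA n V (r + 1) d)
      have e2 := (ih (r + 1) z (by omega) hz (by omega) hz2
        (fun j hj => by have := h3 j hj; omega)).right (row n V' r)
      unfold RA
      have := e1
      simp only [List.append_assoc] at e1 e2 ⊢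
      exact e1.trans e2
    · have hH : ∀ j ≤ n, H j ≤ r := by
        intro j hj
        by_contra hlt
        push Not at hlt
        have hex : ∃ j, r < H j := ⟨j, hlt⟩
        have hf := Nat.find_spec hex
        have hfle := Nat.find_min' hex hlt
        have hpos : Nat.find hex ≠ 0 := by
          intro h0
          rw [h0] at hf
          have := H_mono hc (Nat.zero_le y) (by omega)
          omega
        obtain ⟨z, hzz⟩ := Nat.exists_eq_succ_of_ne_zero hpos
        rw [hzz] at hf hfle
        have hm : ¬ r < H z := Nat.find_min hex (by omega)
        have c := hc z (by omega)
        apply hz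
        refine ⟨z, by omega, ?_, ?_⟩ <;> (unfold Cell at c; simp only [Nat.succ_eq_add_one] at hf; omega)
      unfold RA
      have e1 : RA n V (r + 1) d = RA n V' (r + 1) d := by
        apply RA_congr
        intro j hj r' hr'
        have c := hc j hj
        have := hH j (by omega)
        have := hH (j + 1) (by omega)
        unfold Cell at c; omega
      have e2 : row n V' r = row n V r ++ [2 * y + 1] := by
        have : row0 n V' r = row0 n V r ++ [y] := by
          have cy := hc y hy
          have hlt : ∀ a, a < n ∧ V a = r → a < y := by
            intro a ha
            by_contra hay
            have c := hc a ha.1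
            have := hH (a + 1) (by omega)
            rcases Nat.eq_or_lt_of_le (not_lt.1 hay) with h | h
            · subst h; unfold Cell at c; omega
            · have m1 := H_mono hc (show y + 1 ≤ a by omega) (by omega)
              have m2 := H_mono hc (show a ≤ a + 1 by omega) (by omega)
              unfold Cell at c; omega
          apply sorted_ext (row0_sorted n V' r)
          · rw [List.pairwise_append]
            refine ⟨row0_sorted n V r, by simp, ?_⟩
            intro a ha b hb
            rw [mem_row0] at ha
            simp only [List.mem_singleton] at hb
            subst hb
            exact hlt a ha
          · intro j
            simp only [List.mem_append, mem_row0, List.mem_singleton]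
            by_cases hj : j < n
            · have c := hc j hj
              have l1 := hlt j
              rcases lt_trichotomy j y with h | h | h
              · have m1 := H_mono hc (show j + 1 ≤ y by omega) (by omega)
                have m2 := H_mono hc (show j ≤ y by omega) (by omega)
                unfold Cell at c; omega
              · subst h; unfold Cell at c; omega
              · have m1 := H_mono hc (show y + 1 ≤ j by omega) (by omega)
                have := hH (j + 1) (by omega)
                unfold Cell at c; omega
            · omega
        unfold row
        rw [this]
        simp
      rw [e1, e2, List.append_assoc]
      exact Eqv.refl _

end col

end QC
namespace QC

def cnt (T : ℕ → ℕ) (j r : ℕ) : ℕ := Nat.count (fun i => T i = r) j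

theorem cnt_zero (T : ℕ → ℕ) (r : ℕ) : cnt T 0 r = 0 := by simp [cnt]
theorem cnt_succ (T : ℕ → ℕ) (j r : ℕ) : cnt T (j + 1) r = cnt T j r + if T j = r then 1 else 0 := by
  simp [cnt, Nat.count_succ]
theorem cnt_mono (T : ℕ → ℕ) {a b : ℕ} (h : a ≤ b) (r : ℕ) : cnt T a r ≤ cnt T b r :=
  Nat.count_monotone _ h
theorem cnt_pos {T : ℕ → ℕ} {j r : ℕ} (h : 0 < cnt T j r) : ∃ i < j, T i = r := by
  induction j with
  | zero => simp [cnt_zero] at h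
  | succ j ih =>
    rw [cnt_succ] at h
    by_cases hj : T j = r
    · exact ⟨j, by omega, hj⟩
    · simp [hj] at h
      obtain ⟨i, hi, h'⟩ := ih h
      exact ⟨i, by omega, h'⟩
theorem cnt_pos' {T : ℕ → ℕ} {j r i : ℕ} (h : i < j) (hi : T i = r) : 0 < cnt T j r := by
  have := cnt_mono T (show i + 1 ≤ j from h) r
  rw [cnt_succ] at this
  simp [hi] at this
  omega
theorem cnt_congr {T T' : ℕ → ℕ} {j : ℕ} (h : ∀ i < j, T i = T' i) (r : ℕ) :
    cnt T j r = cnt T' j r := by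
  induction j with
  | zero => simp [cnt_zero]
  | succ j ih =>
    rw [cnt_succ, cnt_succ, ih (fun i hi => h i (by omega)), h j (by omega)]

def Latt (T : ℕ → ℕ) : Prop := ∀ j r, 1 ≤ r → cnt T j (r + 1) ≤ cnt T j r

theorem Latt.anti {T : ℕ → ℕ} (h : Latt T) (j : ℕ) {r r' : ℕ} (hr : 1 ≤ r) (hr' : r ≤ r') :
    cnt T j r' ≤ cnt T j r := by
  induction r', hr' using Nat.le_induction with
  | base => exact le_rfl
  | succ a ha ih => exact (h j a (by omega)).trans ih

theorem mem_RA {n : ℕ} {V : ℕ → ℕ} {x : ℕ} : ∀ {d r : ℕ}, x ∈ RA n V r d ↔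
    ∃ j < n, x = 2 * j + 1 ∧ r ≤ V j ∧ V j < r + d
  | 0, r => by
    simp only [RA, List.not_mem_nil, false_iff]
    rintro ⟨j, _, _, _, _⟩
    omega
  | d + 1, r => by
    simp only [RA, List.mem_append, mem_RA, row, List.mem_map, mem_row0]
    constructor
    · rintro (⟨j, h1, h2, h3, h4⟩ | ⟨j, ⟨h1, h2⟩, h3⟩)
      · exact ⟨j, h1, h2, by omega, by omega⟩
      · exact ⟨j, h1, by omega, by omega, by omega⟩
    · rintro ⟨j, h1, h2, h3, h4⟩
      by_cases h : V j = r
      · exact Or.inr ⟨j, ⟨h1, h⟩, h2.symm⟩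
      · exact Or.inl ⟨j, h1, h2, by omega, by omega⟩

theorem RA_pairwise {n : ℕ} {V : ℕ → ℕ} : ∀ (d r : ℕ), (RA n V r d).Pairwise
    (fun x y => V (y / 2) < V (x / 2) ∨ (V (x / 2) = V (y / 2) ∧ x < y))
  | 0, r => by simp [RA]
  | d + 1, r => by
    unfold RA
    rw [List.pairwise_append]
    refine ⟨RA_pairwise d (r + 1), ?_, ?_⟩
    · unfold row
      rw [List.pairwise_map]
      refine (row0_sorted n V r).imp_of_mem ?_
      intro a b ha hb hab
      rw [mem_row0] at ha hb
      right
      have e1 : (2 * a + 1) / 2 = a := by omega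
      have e2 : (2 * b + 1) / 2 = b := by omega
      rw [e1, e2]
      exact ⟨by omega, by omega⟩
    · intro x hx y hy
      left
      obtain ⟨j, h1, rfl, h3, h4⟩ := mem_RA.1 hx
      simp only [row, List.mem_map, mem_row0] at hy
      obtain ⟨i, hi, rfl⟩ := hy
      have e1 : (2 * i + 1) / 2 = i := by omega
      have e2 : (2 * j + 1) / 2 = j := by omega
      rw [e1, e2]
      omega

theorem RA_succ' {n : ℕ} {V : ℕ → ℕ} : ∀ (d r : ℕ), RA n V r (d + 1) = row n V (r + d) ++ RA n V r d
  | 0, r => by simp [RA]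
  | d + 1, r => by
    rw [RA, RA_succ' d (r + 1), RA]
    rw [show r + 1 + d = r + (d + 1) by omega, List.append_assoc]

theorem RA_sublist {n : ℕ} {V : ℕ → ℕ} {d d' : ℕ} (h : d ≤ d') (r : ℕ) :
    (RA n V r d).Sublist (RA n V r d') := by
  induction d', h using Nat.le_induction with
  | base => exact List.Sublist.refl _
  | succ a ha ih =>
    rw [RA_succ']
    exact ih.trans (List.sublist_append_right _ _)

theorem len_le_of_nodup {s : List ℕ} {N : ℕ} (h : s.Nodup) (h2 : ∀ x ∈ s, 1 ≤ x ∧ x ≤ N) :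
    s.length ≤ N := by
  rw [← List.toFinset_card_of_nodup h]
  have : s.toFinset ⊆ Finset.Icc 1 N := by
    intro x hx
    simp at hx ⊢
    exact h2 x hx
  simpa using Finset.card_le_card this

theorem inc_le {n d : ℕ} {T : ℕ → ℕ} (hT : Latt T) {s : List ℕ} (hs : s.Sublist (RA n T 1 d))
    (hp : s.Pairwise (· < ·)) {m : ℕ} (hm : ∀ x ∈ s, x < 2 * m) : s.length ≤ cnt T m 1 := by
  have hpp := List.pairwise_and_iff.2 ⟨hp, (RA_pairwise d 1).sublist hs⟩
  have h1 : (s.map (fun x => cnt T (x / 2 + 1) (T (x / 2)))).Pairwise (· < ·) := by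
    rw [List.pairwise_map]
    refine hpp.imp_of_mem ?_
    rintro a b ha hb ⟨hab, h⟩
    obtain ⟨i, hi, rfl, hi1, -⟩ := mem_RA.1 (hs.subset ha)
    obtain ⟨j, hj, rfl, hj1, -⟩ := mem_RA.1 (hs.subset hb)
    have e1 : (2 * i + 1) / 2 = i := by omega
    have e2 : (2 * j + 1) / 2 = j := by omega
    rw [e1, e2] at h ⊢
    have a1 := cnt_succ T j (T j)
    simp at a1
    have a2 := cnt_mono T (show i + 1 ≤ j by omega) (T j)
    have a3 := hT.anti (i + 1) hj1 (show T j ≤ T i by omega)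
    omega
  have h2 := len_le_of_nodup (N := cnt T m 1) (h1.imp (fun h => Nat.ne_of_lt h)) (by
    intro c hc
    obtain ⟨x, hx, rfl⟩ := List.mem_map.1 hc
    have hx2 := hm x hx
    obtain ⟨i, hi, rfl, hi1, -⟩ := mem_RA.1 (hs.subset hx)
    have e1 : (2 * i + 1) / 2 = i := by omega
    simp only [e1]
    refine ⟨cnt_pos' (Nat.lt_succ_self i) rfl, ?_⟩
    exact (hT.anti (i + 1) le_rfl hi1).trans (cnt_mono T (by omega) 1))
  simpa using h2

theorem dec_le {n d : ℕ} {T : ℕ → ℕ} {s : List ℕ} (hs : s.Sublist (RA n T 1 d))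
    (hp : s.Pairwise (· > ·)) {q : ℕ} (hm : ∀ x ∈ s, T (x / 2) ≤ q) : s.length ≤ q := by
  have hpp := List.pairwise_and_iff.2 ⟨hp, (RA_pairwise d 1).sublist hs⟩
  have h1 : (s.map (fun x => T (x / 2))).Pairwise (· > ·) := by
    rw [List.pairwise_map]
    refine hpp.imp ?_
    rintro a b ⟨hab, h⟩
    omega
  have h2 := len_le_of_nodup (N := q) (h1.imp (fun h => Nat.ne_of_gt h)) (by
    intro c hc
    obtain ⟨x, hx, rfl⟩ := List.mem_map.1 hc
    refine ⟨?_, hm x hx⟩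
    obtain ⟨i, hi, rfl, hi1, -⟩ := mem_RA.1 (hs.subset hx)
    have e1 : (2 * i + 1) / 2 = i := by omega
    rw [e1]; exact hi1)
  simpa using h2

theorem row_length (n : ℕ) (T : ℕ → ℕ) (r : ℕ) : (row n T r).length = cnt T n r := by
  simp only [row, row0, List.length_map]
  induction n with
  | zero => simp [cnt_zero]
  | succ n ih =>
    rw [List.range_succ, List.filter_append, List.length_append, ih, cnt_succ]
    congr 1
    by_cases h : T n = r <;> simp [h]

theorem row_sorted (n : ℕ) (T : ℕ → ℕ) (r : ℕ) : (row n T r).Pairwise (· < ·) := by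
  unfold row
  rw [List.pairwise_map]
  exact (row0_sorted n T r).imp (fun h => by omega)

theorem exists_prev {T : ℕ → ℕ} (hT : Latt T) {j r : ℕ} (hr : 1 ≤ r) (hj : T j = r + 1) :
    ∃ i < j, T i = r := by
  have h1 := cnt_pos' (Nat.lt_succ_self j) hj
  have h2 := hT (j + 1) r hr
  obtain ⟨i, hi, h⟩ := cnt_pos (show 0 < cnt T (j + 1) r by
    simp only [Nat.succ_eq_add_one] at h1; omega)
  refine ⟨i, ?_, h⟩
  rcases Nat.lt_succ_iff_lt_or_eq.1 hi with h' | h'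
  · exact h'
  · subst h'; omega

theorem label_le {T : ℕ → ℕ} (hT : Latt T) : ∀ (r j : ℕ), T j = r → r ≤ j + 1
  | 0, _, _ => by omega
  | 1, _, _ => by omega
  | r + 2, j, h => by
    obtain ⟨i, hi, h'⟩ := exists_prev hT (by omega) h
    have := label_le hT (r + 1) i h'
    omega

theorem exists_dec {n : ℕ} {T : ℕ → ℕ} (hT : Latt T) : ∀ (r j : ℕ), j < n → T j = r + 1 →
    ∃ s : List ℕ, s.Sublist (RA n T 1 (r + 1)) ∧ s.Pairwise (· > ·) ∧ s.length = r + 1 ∧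
      ∀ x ∈ s, x ≤ 2 * j + 1
  | 0, j, hj, h => by
    refine ⟨[2 * j + 1], ?_, by simp, rfl, by simp⟩
    rw [List.singleton_sublist]
    exact mem_RA.2 ⟨j, hj, rfl, by omega, by omega⟩
  | r + 1, j, hj, h => by
    obtain ⟨i, hi, h'⟩ := exists_prev hT (by omega) h
    obtain ⟨s, h1, h2, h3, h4⟩ := exists_dec (n := n) hT r i (by omega) h'
    refine ⟨(2 * j + 1) :: s, ?_, ?_, by simp [h3], ?_⟩
    · rw [RA_succ']
      have : [2 * j + 1].Sublist (row n T (1 + (r + 1))) := by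
        rw [List.singleton_sublist]
        simp only [row, List.mem_map, mem_row0]
        exact ⟨j, ⟨hj, by omega⟩, rfl⟩
      exact this.append h1
    · rw [List.pairwise_cons]
      exact ⟨fun x hx => by have := h4 x hx; omega, h2⟩
    · intro x hx
      rcases List.mem_cons.1 hx with rfl | hx
      · exact le_rfl
      · have := h4 x hx; omega

def IsTab (n : ℕ) (T : ℕ → ℕ) : Prop := (∀ j, T j = 0 ↔ n ≤ j) ∧ Latt T

def read (n : ℕ) (T : ℕ → ℕ) : List ℕ := RA n T 1 n

theorem read_inc {n : ℕ} {T : ℕ → ℕ} (hT : IsTab n T) (p : ℕ) :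
    Ch (· < ·) p (read n T) ↔ p ≤ cnt T n 1 := by
  constructor
  · rintro ⟨s, h1, h2, h3⟩
    rw [← h3]
    apply inc_le hT.2 h1 h2
    intro x hx
    obtain ⟨i, hi, rfl, hi1, -⟩ := mem_RA.1 (h1.subset hx)
    omega
  · intro h
    have : Ch (· < ·) (cnt T n 1) (read n T) := by
      refine ⟨row n T 1, ?_, row_sorted n T 1, row_length n T 1⟩
      unfold read
      cases n with
      | zero => simp [row, row0]
      | succ n => exact List.sublist_append_right _ _
    exact this.le h

theorem read_dec {n : ℕ} {T : ℕ → ℕ} (hT : IsTab n T) (q : ℕ) :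
    Ch (· > ·) (q + 1) (read n T) ↔ 0 < cnt T n (q + 1) := by
  constructor
  · rintro ⟨s, h1, h2, h3⟩
    by_contra h0
    have : s.length ≤ q := by
      apply dec_le h1 h2
      intro x hx
      obtain ⟨i, hi, rfl, hi1, -⟩ := mem_RA.1 (h1.subset hx)
      have e1 : (2 * i + 1) / 2 = i := by omega
      rw [e1]
      by_contra hlt
      have := cnt_pos' hi rfl (T := T)
      have := hT.2.anti n (show 1 ≤ q + 1 by omega) (show q + 1 ≤ T i by omega)
      omega
    omega
  · intro h
    obtain ⟨j, hj, h'⟩ := cnt_pos h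
    obtain ⟨s, h1, h2, h3, -⟩ := exists_dec hT.2 q j hj h'
    have := label_le hT.2 _ j h'
    exact ⟨s, h1.trans (RA_sublist (by omega) 1), h2, h3⟩

/-- the tableau/word version of bicruciality. -/
def RT (k l : ℕ) (u : List ℕ) : Prop :=
  (¬ Ch (· < ·) k u ∧ ¬ Ch (· > ·) l u) ∧ ∀ i : ℕ,
    (Ch (· < ·) k (u ++ [2 * i]) ∨ Ch (· > ·) l (u ++ [2 * i])) ∧
    (Ch (· < ·) k (2 * i :: u) ∨ Ch (· > ·) l (2 * i :: u))

theorem RT_congr {k l : ℕ} {u v : List ℕ} (h : Eqv u v) : RT k l u ↔ RT k l v := by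
  have h0 := fun p => h [] [] p
  have h1 := fun i p => h [] [2 * i] p
  have h2 := fun i p => h [2 * i] [] p
  simp only [List.nil_append, List.append_nil, List.singleton_append] at h0 h1 h2
  unfold RT
  simp only [h0, h1, h2]

def Good (k l n : ℕ) (T : ℕ → ℕ) : Prop := IsTab n T ∧ RT k l (read n T)

end QC
namespace QC

theorem ch_snoc {R : ℕ → ℕ → Prop} {p y : ℕ} {u : List ℕ} (h : Ch R p (u ++ [y])) :
    Ch R p u ∨ ∃ s : List ℕ, s.Sublist u ∧ s.Pairwise R ∧ s.length + 1 = p ∧ ∀ x ∈ s, R x y := by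
  obtain ⟨s, h1, h2, h3⟩ := h
  obtain ⟨a, b, rfl, ha, hb⟩ := List.sublist_append_iff.1 h1
  rcases List.sublist_cons_iff.1 hb with hb | ⟨c, rfl, hb'⟩
  · rw [List.sublist_nil] at hb
    subst hb
    left
    exact ⟨a, ha, by simpa using h2, by simpa using h3⟩
  · rw [List.sublist_nil] at hb'
    subst hb'
    right
    rw [List.pairwise_append] at h2
    exact ⟨a, ha, h2.1, by simpa using h3, fun x hx => h2.2.2 x hx y (by simp)⟩

theorem ch_cons {R : ℕ → ℕ → Prop} {p y : ℕ} {u : List ℕ} (h : Ch R p (y :: u)) :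
    Ch R p u ∨ ∃ s : List ℕ, s.Sublist u ∧ s.Pairwise R ∧ s.length + 1 = p ∧ ∀ x ∈ s, R y x := by
  obtain ⟨s, h1, h2, h3⟩ := h
  rcases List.sublist_cons_iff.1 h1 with hb | ⟨c, rfl, hb⟩
  · left
    exact ⟨s, hb, h2, h3⟩
  · right
    rw [List.pairwise_cons] at h2
    exact ⟨c, hb, h2.2, by simpa using h3, h2.1⟩

theorem ch_snoc' {R : ℕ → ℕ → Prop} {p y : ℕ} {u s : List ℕ} (h1 : s.Sublist u)
    (h2 : s.Pairwise R) (h3 : s.length + 1 = p) (h4 : ∀ x ∈ s, R x y) : Ch R p (u ++ [y]) :=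
  ⟨s ++ [y], h1.append (List.Sublist.refl _), by
    rw [List.pairwise_append]; exact ⟨h2, by simp, by simpa using h4⟩, by simpa using h3⟩

theorem ch_cons' {R : ℕ → ℕ → Prop} {p y : ℕ} {u s : List ℕ} (h1 : s.Sublist u)
    (h2 : s.Pairwise R) (h3 : s.length + 1 = p) (h4 : ∀ x ∈ s, R y x) : Ch R p (y :: u) :=
  ⟨y :: s, h1.cons_cons _, by
    rw [List.pairwise_cons]; exact ⟨h4, h2⟩, by simpa using h3⟩

theorem good_facts {p q n : ℕ} {T : ℕ → ℕ} (hp : 1 ≤ p) (hq : 1 ≤ q)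
    (h : Good (p + 1) (q + 1) n T) : cnt T n 1 = p ∧ cnt T n (q + 1) = 0 ∧ 0 < cnt T n q := by
  obtain ⟨hT, ⟨h1, h2⟩, h3⟩ := h
  have i1 := h1
  have i2 := h2
  rw [read_inc hT] at i1
  rw [read_dec hT] at i2
  have hmem : ∀ x ∈ read n T, 0 < x ∧ x < 2 * n := by
    intro x hx
    obtain ⟨i, hi, rfl, hi1, -⟩ := mem_RA.1 hx
    omega
  have a1 : Ch (· < ·) p (read n T) := by
    rcases (h3 n).1 with h | h
    · rcases ch_snoc h with h | ⟨s, s1, s2, s3, s4⟩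
      · exact absurd h h1
      · exact ⟨s, s1, s2, by omega⟩
    · rcases ch_snoc h with h | ⟨s, s1, s2, s3, s4⟩
      · exact absurd h h2
      · obtain ⟨x, hx⟩ := List.exists_mem_of_length_pos (show 0 < s.length by omega)
        have := hmem x (s1.subset hx)
        have := s4 x hx
        omega
  have a2 : Ch (· > ·) q (read n T) := by
    rcases (h3 0).1 with h | h
    · rcases ch_snoc h with h | ⟨s, s1, s2, s3, s4⟩
      · exact absurd h h1
      · obtain ⟨x, hx⟩ := List.exists_mem_of_length_pos (show 0 < s.length by omega)
        have := s4 x hx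
        omega
    · rcases ch_snoc h with h | ⟨s, s1, s2, s3, s4⟩
      · exact absurd h h2
      · exact ⟨s, s1, s2, by omega⟩
  rw [read_inc hT] at a1
  obtain ⟨q', rfl⟩ := Nat.exists_eq_add_of_le' hq
  rw [read_dec hT] at a2
  exact ⟨by omega, by omega, a2⟩

theorem sum_cnt {T : ℕ → ℕ} {h : ℕ} : ∀ n : ℕ, (∀ j < n, 1 ≤ T j ∧ T j ≤ h) →
    ∑ r ∈ Finset.range h, cnt T n (r + 1) = n
  | 0, _ => by simp [cnt_zero]
  | n + 1, H => by
    simp only [cnt_succ]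
    rw [Finset.sum_add_distrib, sum_cnt n (fun j hj => H j (by omega))]
    congr 1
    have := H n (by omega)
    rw [Finset.sum_eq_single (T n - 1)]
    · simp; omega
    · intro b _ hb
      simp; omega
    · intro hb
      simp at hb; omega

theorem tab_le {T : ℕ → ℕ} {n h : ℕ} (hT : IsTab n T) (h0 : cnt T n (h + 1) = 0) :
    ∀ j < n, 1 ≤ T j ∧ T j ≤ h := by
  intro j hj
  have h1 : T j ≠ 0 := fun e => by have := (hT.1 j).1 e; omega
  refine ⟨by omega, ?_⟩
  by_contra hlt
  have := cnt_pos' hj rfl (T := T)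
  have := hT.2.anti n (show 1 ≤ h + 1 by omega) (show h + 1 ≤ T j by omega)
  omega

/-- The row to be extended. -/
noncomputable def crn (w n : ℕ) (T : ℕ → ℕ) : ℕ := sInf {r | 1 ≤ r ∧ cnt T n r < w}

noncomputable def ext (w n : ℕ) (T : ℕ → ℕ) : ℕ → ℕ := Function.update T n (crn w n T)

theorem ext_lt {w n : ℕ} {T : ℕ → ℕ} {j : ℕ} (hj : j < n) : ext w n T j = T j := by
  unfold ext
  rw [Function.update_of_ne (by omega)]

theorem ext_cnt {w n : ℕ} {T : ℕ → ℕ} {j : ℕ} (hj : j ≤ n) (r : ℕ) :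
    cnt (ext w n T) j r = cnt T j r :=
  cnt_congr (fun i hi => ext_lt (by omega)) r

theorem ext_cnt' {w n : ℕ} {T : ℕ → ℕ} (r : ℕ) :
    cnt (ext w n T) (n + 1) r = cnt T n r + if crn w n T = r then 1 else 0 := by
  rw [cnt_succ, ext_cnt le_rfl]
  simp [ext]

theorem cnt_const {n : ℕ} {T : ℕ → ℕ} (h : ∀ j, n ≤ j → T j = 0) {r : ℕ} (hr : 1 ≤ r) {j : ℕ}
    (hj : n ≤ j) : cnt T j r = cnt T n r := by
  induction j, hj using Nat.le_induction with
  | base => rfl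
  | succ j hj ih =>
    rw [cnt_succ, ih, h j hj]
    simp; omega

theorem ext_tab {w h n : ℕ} {T : ℕ → ℕ} (hT : IsTab n T) (hw : cnt T n 1 ≤ w)
    (hh : cnt T n (h + 1) = 0) (hn : n < w * h) : IsTab (n + 1) (ext w n T) ∧
      cnt (ext w n T) (n + 1) 1 ≤ w ∧ cnt (ext w n T) (n + 1) (h + 1) = 0 := by
  have hex : ∃ r, 1 ≤ r ∧ r ≤ h ∧ cnt T n r < w := by
    by_contra hcon
    push Not at hcon
    have := sum_cnt n (tab_le hT hh)
    have h2 : ∑ r ∈ Finset.range h, w ≤ ∑ r ∈ Finset.range h, cnt T n (r + 1) :=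
      Finset.sum_le_sum (fun r hr => hcon (r + 1) (by omega) (by simp at hr; omega))
    simp at h2
    rw [mul_comm] at h2
    omega
  obtain ⟨r0, hr0, hr0', hr0''⟩ := hex
  have hne : {r | 1 ≤ r ∧ cnt T n r < w}.Nonempty := ⟨r0, hr0, hr0''⟩
  have hc : 1 ≤ crn w n T ∧ cnt T n (crn w n T) < w := Nat.sInf_mem hne
  have hc2 : crn w n T ≤ r0 := Nat.sInf_le ⟨hr0, hr0''⟩
  have hmin : ∀ r, 1 ≤ r → r < crn w n T → w ≤ cnt T n r := by
    intro r h1 h2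
    by_contra h3
    have : crn w n T ≤ r := Nat.sInf_le ⟨h1, by omega⟩
    omega
  refine ⟨⟨?_, ?_⟩, ?_, ?_⟩
  · intro j
    rcases lt_trichotomy j n with h1 | h1 | h1
    · rw [ext_lt h1, hT.1 j]; omega
    · subst h1
      simp [ext]; omega
    · unfold ext
      rw [Function.update_of_ne (by omega), hT.1 j]; omega
  · have key : ∀ r, 1 ≤ r → cnt (ext w n T) (n + 1) (r + 1) ≤ cnt (ext w n T) (n + 1) r := by
      intro r hr
      rw [ext_cnt', ext_cnt']
      have h1 := hT.2 n r hr
      by_cases e : crn w n T = r + 1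
      · have := hmin r hr (by omega)
        rw [e] at hc
        simp [e]; omega
      · simp [e]; omega
    intro j r hr
    rcases le_or_gt j n with h1 | h1
    · rw [ext_cnt h1, ext_cnt h1]; exact hT.2 j r hr
    · have hz : ∀ j, n + 1 ≤ j → ext w n T j = 0 := by
        intro j hj
        unfold ext
        rw [Function.update_of_ne (by omega), hT.1 j]; omega
      rw [cnt_const hz (by omega) h1, cnt_const hz hr h1]
      exact key r hr
  · rw [ext_cnt']
    by_cases e : crn w n T = 1
    · rw [e] at hc; simp [e]; omega
    · simp [e, hw]
  · rw [ext_cnt', hh]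
    simp; omega

theorem RA_sub {n n' : ℕ} {T T' : ℕ → ℕ} (hn : n ≤ n') (h : ∀ j < n, T j = T' j) :
    ∀ (d r : ℕ), (RA n T r d).Sublist (RA n' T' r d)
  | 0, _ => List.Sublist.refl _
  | d + 1, r => by
    unfold RA
    refine (RA_sub hn h d (r + 1)).append ?_
    unfold row
    apply List.Sublist.map
    have : row0 n T r = row0 n T' r := by
      unfold row0
      apply List.filter_congr
      intro j hj
      rw [h j (List.mem_range.1 hj)]
    rw [this]
    unfold row0
    apply List.Sublist.filter
    rw [List.range_sublist]
    exact hn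

theorem RT_mono {k l : ℕ} {u v : List ℕ} (h : RT k l u) (huv : u.Sublist v)
    (h1 : ¬ Ch (· < ·) k v) (h2 : ¬ Ch (· > ·) l v) : RT k l v := by
  refine ⟨⟨h1, h2⟩, fun i => ⟨?_, ?_⟩⟩
  · rcases (h.2 i).1 with h | h
    · exact Or.inl (h.mono (huv.append (List.Sublist.refl _)))
    · exact Or.inr (h.mono (huv.append (List.Sublist.refl _)))
  · rcases (h.2 i).2 with h | h
    · exact Or.inl (h.mono (huv.cons_cons _))
    · exact Or.inr (h.mono (huv.cons_cons _))

theorem ext_good {p q n : ℕ} {T : ℕ → ℕ} (hp : 1 ≤ p) (hq : 1 ≤ q)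
    (h : Good (p + 1) (q + 1) n T) (hn : n < p * q) : Good (p + 1) (q + 1) (n + 1) (ext p n T) := by
  obtain ⟨f1, f2, f3⟩ := good_facts hp hq h
  obtain ⟨g1, g2, g3⟩ := ext_tab h.1 f1.le f2 hn
  refine ⟨g1, RT_mono h.2 ?_ ?_ ?_⟩
  · unfold read
    exact (RA_sub (by omega) (fun j hj => (ext_lt hj).symm) _ _).trans (RA_sublist (by omega) _)
  · rw [read_inc g1]; omega
  · rw [read_dec g1]; omega

def GP (k l n : ℕ) : Type :=
  {x : (ℕ → ℕ) × (ℕ → ℕ) // Good k l n x.1 ∧ Good k l n x.2 ∧ ∀ r, 1 ≤ r → cnt x.1 n r = cnt x.2 n r}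

theorem crn_congr {w n : ℕ} {T T' : ℕ → ℕ} (h : ∀ r, 1 ≤ r → cnt T n r = cnt T' n r) :
    crn w n T = crn w n T' := by
  unfold crn
  congr 1
  ext r
  constructor
  · rintro ⟨h1, h2⟩; exact ⟨h1, by rw [← h r h1]; exact h2⟩
  · rintro ⟨h1, h2⟩; exact ⟨h1, by rw [h r h1]; exact h2⟩

theorem ext_inj {w n : ℕ} {T T' : ℕ → ℕ} (h0 : T n = 0) (h0' : T' n = 0)
    (h : ext w n T = ext w n T') : T = T' := by
  funext j
  by_cases hj : j = n
  · subst hj; rw [h0, h0']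
  · have := congrFun h j
    unfold ext at this
    rwa [Function.update_of_ne hj, Function.update_of_ne hj] at this

noncomputable def gpExt {p q n : ℕ} (hp : 1 ≤ p) (hq : 1 ≤ q) (hn : n < p * q)
    (x : GP (p + 1) (q + 1) n) : GP (p + 1) (q + 1) (n + 1) :=
  ⟨(ext p n x.1.1, ext p n x.1.2), ext_good hp hq x.2.1 hn, ext_good hp hq x.2.2.1 hn, by
    intro r hr
    simp only [ext_cnt', crn_congr x.2.2.2, x.2.2.2 r hr]⟩

theorem gpExt_inj {p q n : ℕ} (hp : 1 ≤ p) (hq : 1 ≤ q) (hn : n < p * q) :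
    Function.Injective (gpExt (n := n) hp hq hn) := by
  rintro ⟨⟨a, b⟩, h1⟩ ⟨⟨c, d⟩, h2⟩ h
  have h3 := congrArg (fun x => x.1.1) h
  have h4 := congrArg (fun x => x.1.2) h
  simp only [gpExt] at h3 h4
  apply Subtype.ext
  simp only [Prod.mk.injEq]
  refine ⟨ext_inj ((h1.1.1.1 n).2 le_rfl) ((h2.1.1.1 n).2 le_rfl) h3,
    ext_inj ((h1.2.1.1.1 n).2 le_rfl) ((h2.2.1.1.1 n).2 le_rfl) h4⟩

end QC
namespace QC

def blk (m s : ℕ) (T : ℕ → ℕ) : ℕ → ℕ := fun j => if j < m then T j else if j < m + s then j - m + 1 else 0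

theorem blk_lt {m s : ℕ} {T : ℕ → ℕ} {j : ℕ} (h : j < m) : blk m s T j = T j := by simp [blk, h]
theorem blk_mid {m s : ℕ} {T : ℕ → ℕ} {i : ℕ} (h : i < s) : blk m s T (m + i) = i + 1 := by
  simp [blk, h]

theorem blk_cnt_lt {m s : ℕ} {T : ℕ → ℕ} {j : ℕ} (h : j ≤ m) (r : ℕ) :
    cnt (blk m s T) j r = cnt T j r := cnt_congr (fun i hi => blk_lt (by omega)) r

theorem blk_cnt {m s : ℕ} {T : ℕ → ℕ} (r : ℕ) : ∀ i : ℕ, i ≤ s →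
    cnt (blk m s T) (m + i) r = cnt T m r + if 1 ≤ r ∧ r ≤ i then 1 else 0
  | 0, _ => by
    rw [Nat.add_zero, blk_cnt_lt le_rfl]
    rw [if_neg (by omega)]
    rfl
  | i + 1, h => by
    rw [← Nat.add_assoc, cnt_succ, blk_cnt r i (by omega), blk_mid (by omega)]
    split_ifs <;> omega

theorem blk_tab {m s : ℕ} {T : ℕ → ℕ} (hT : IsTab m T) : IsTab (m + s) (blk m s T) := by
  have hz : ∀ j, m + s ≤ j → blk m s T j = 0 := by
    intro j hj
    have h1 : ¬ j < m := by omega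
    have h2 : ¬ j < m + s := by omega
    simp [blk, h1, h2]
  have key : ∀ j, j ≤ m + s → ∀ r, 1 ≤ r →
      cnt (blk m s T) j (r + 1) ≤ cnt (blk m s T) j r := by
    intro j hj r hr
    rcases le_or_gt j m with h | h
    · rw [blk_cnt_lt h, blk_cnt_lt h]; exact hT.2 j r hr
    · obtain ⟨i, rfl⟩ := Nat.exists_eq_add_of_lt h
      have := hT.2 m r hr
      rw [Nat.add_assoc, blk_cnt _ _ (by omega), blk_cnt _ _ (by omega)]
      split_ifs <;> omega
  refine ⟨fun j => ?_, fun j r hr => ?_⟩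
  · constructor
    · intro h
      by_contra hlt
      unfold blk at h
      have := hT.1 j
      split_ifs at h <;> omega
    · exact hz j
  · rcases le_or_gt j (m + s) with h | h
    · exact key j h r hr
    · rw [cnt_const hz (by omega) h.le, cnt_const hz hr h.le]
      exact key _ le_rfl r hr

theorem exists_base {q : ℕ} (hq : 1 ≤ q) : ∀ a : ℕ, ∃ T, IsTab (q + a) T ∧ (∀ j < q, T j = j + 1) ∧
    cnt T (q + a) 1 = a + 1 ∧ cnt T (q + a) (q + 1) = 0
  | 0 => by
    have h0 : IsTab 0 (fun _ => 0) := by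
      refine ⟨fun j => by simp, fun j r hr => ?_⟩
      rw [cnt_const (n := 0) (fun _ _ => rfl) (by omega) (Nat.zero_le j), cnt_zero]
      exact Nat.zero_le _
    have h1 := blk_tab (s := q) h0
    rw [Nat.zero_add] at h1
    refine ⟨blk 0 q (fun _ => 0), h1, ?_, ?_, ?_⟩
    · intro j hj
      have := blk_mid (m := 0) (T := fun _ => 0) hj
      rwa [Nat.zero_add] at this
    · have := blk_cnt (m := 0) (T := fun _ => 0) 1 q le_rfl
      rw [Nat.zero_add] at this
      rw [Nat.add_zero, this]
      simp [cnt_zero, hq]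
    · have := blk_cnt (m := 0) (T := fun _ => 0) (q + 1) q le_rfl
      rw [Nat.zero_add] at this
      rw [Nat.add_zero, this]
      simp [cnt_zero]
  | a + 1 => by
    obtain ⟨T, h1, h2, h3, h4⟩ := exists_base hq a
    refine ⟨blk (q + a) 1 T, blk_tab h1, ?_, ?_, ?_⟩
    · intro j hj
      rw [blk_lt (by omega), h2 j hj]
    · rw [← Nat.add_assoc, blk_cnt _ _ le_rfl, h3]
      simp
    · rw [← Nat.add_assoc, blk_cnt _ _ le_rfl, h4]
      simp; omega

theorem exists_mid {q a w : ℕ} (hq : 1 ≤ q) (haw : a ≤ w) : w ≤ a * q →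
    ∃ T, IsTab (q + w) T ∧ (∀ j < q, T j = j + 1) ∧
    cnt T (q + w) 1 = a + 1 ∧ cnt T (q + w) (q + 1) = 0 := by
  induction w, haw using Nat.le_induction with
  | base => exact fun _ => exists_base hq a
  | succ w hw ih =>
    intro hle
    obtain ⟨T, h1, h2, h3, h4⟩ := ih (by omega)
    obtain ⟨g1, g2, g3⟩ := ext_tab h1 h3.le h4 (by rw [Nat.add_mul, Nat.one_mul]; omega)
    refine ⟨ext (a + 1) (q + w) T, g1, ?_, ?_, g3⟩
    · intro j hj
      rw [ext_lt (by omega), h2 j hj]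
    · have := ext_cnt' (w := a + 1) (n := q + w) (T := T) 1
      rw [← Nat.add_assoc]
      omega

theorem blk_dec {N m s : ℕ} {T : ℕ → ℕ} (hT : ∀ i < s, T (m + i) = i + 1) (hN : m + s ≤ N) :
    ∀ r ≤ s, ∃ D : List ℕ, D.Sublist (RA N T 1 r) ∧ D.Pairwise (· > ·) ∧ D.length = r ∧
      ∀ x ∈ D, 2 * m + 1 ≤ x ∧ x < 2 * (m + r)
  | 0, _ => ⟨[], by simp, by simp, rfl, by simp⟩
  | r + 1, h => by
    obtain ⟨D, h1, h2, h3, h4⟩ := blk_dec hT hN r (by omega)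
    refine ⟨(2 * (m + r) + 1) :: D, ?_, ?_, by simp [h3], ?_⟩
    · rw [RA_succ']
      have : [2 * (m + r) + 1].Sublist (row N T (1 + r)) := by
        rw [List.singleton_sublist]
        simp only [row, List.mem_map, mem_row0]
        exact ⟨m + r, ⟨by omega, by rw [hT r (by omega)]; omega⟩, rfl⟩
      exact this.append h1
    · rw [List.pairwise_cons]
      exact ⟨fun x hx => by have := h4 x hx; omega, h2⟩
    · intro x hx
      rcases List.mem_cons.1 hx with rfl | hx
      · omega
      · have := h4 x hx; omega

theorem row1_sublist {N d : ℕ} {T : ℕ → ℕ} (hd : 1 ≤ d) : (row N T 1).Sublist (RA N T 1 d) := by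
  have h := RA_sublist (n := N) (V := T) hd 1
  simpa [RA] using h

theorem exists_special {q a n : ℕ} (hq : 2 ≤ q) (h1 : a + 2 * q ≤ n + 1) (h2 : n < (a + 2) * q) :
    ∃ T0, Good (a + 3) (q + 1) (n + 1) T0 ∧
      ∀ T, Good (a + 3) (q + 1) n T → ext (a + 2) n T ≠ T0 := by
  obtain ⟨w, hw⟩ := Nat.exists_eq_add_of_le (show 2 * q ≤ n + 1 by omega)
  have haw : a ≤ w := by omega
  have hwa : w ≤ a * q := by
    rw [Nat.add_mul] at h2; omega
  obtain ⟨T1, t1, t2, t3, t4⟩ := exists_mid (by omega) haw hwa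
  obtain ⟨m, hm⟩ : ∃ m, m = q + w := ⟨_, rfl⟩
  rw [← hm] at t1 t3 t4
  have hN : n + 1 = m + q := by omega
  obtain ⟨T0, hT0⟩ : ∃ T0, T0 = blk m q T1 := ⟨_, rfl⟩
  have tab : IsTab (n + 1) T0 := by rw [hN, hT0]; exact blk_tab t1
  have c1 : cnt T0 (n + 1) 1 = a + 2 := by
    rw [hN, hT0, blk_cnt _ _ le_rfl, t3]
    have : 1 ≤ 1 ∧ 1 ≤ q := by omega
    simp [this]
  have cq : cnt T0 (n + 1) (q + 1) = 0 := by
    rw [hN, hT0, blk_cnt _ _ le_rfl, t4]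
    simp
  have first : ∀ i < q, T0 (0 + i) = i + 1 := by
    intro i hi
    rw [Nat.zero_add, hT0, blk_lt (by omega), t2 i hi]
  have last : ∀ i < q, T0 (m + i) = i + 1 := by
    intro i hi
    rw [hT0, blk_mid hi]
  refine ⟨T0, ⟨tab, ⟨?_, ?_⟩, fun i => ⟨?_, ?_⟩⟩, ?_⟩
  · rw [read_inc tab]; omega
  · rw [read_dec tab]; omega
  · unfold read
    by_cases hi : m < i
    · left
      refine ch_snoc' (row1_sublist (N := n + 1) (by omega)) (row_sorted _ _ _) ?_ ?_
      · rw [row_length, c1]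
      · intro x hx
        simp only [row, List.mem_map, mem_row0] at hx
        obtain ⟨j, ⟨hj, hj1⟩, rfl⟩ := hx
        by_cases hjm : j < m
        · omega
        · have := last (j - m) (by omega)
          rw [show m + (j - m) = j by omega] at this
          omega
    · right
      obtain ⟨D, d1, d2, d3, d4⟩ := blk_dec last (by omega : m + q ≤ n + 1) q le_rfl
      refine ch_snoc' (d1.trans (RA_sublist (by omega) 1)) d2 (by omega) ?_
      intro x hx
      have := d4 x hx
      omega
  · unfold read
    by_cases hi : q ≤ i
    · right
      obtain ⟨D, d1, d2, d3, d4⟩ := blk_dec first (by omega : 0 + q ≤ n + 1) q le_rfl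
      refine ch_cons' (d1.trans (RA_sublist (by omega) 1)) d2 (by omega) ?_
      intro x hx
      have := d4 x hx
      omega
    · left
      have htail : ∀ x ∈ (row (n + 1) T0 1).tail, 2 * q + 1 ≤ x := by
        intro x hx
        have hmem := List.mem_of_mem_tail hx
        have hx1 : 1 < x := by
          have hs := row_sorted (n + 1) T0 1
          cases hr : row (n + 1) T0 1 with
          | nil => rw [hr] at hx; simp at hx
          | cons b B =>
            rw [hr] at hx hs
            have hbx := (List.pairwise_cons.1 hs).1 x hx
            have hb : b ∈ row (n + 1) T0 1 := by rw [hr]; simp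
            simp only [row, List.mem_map, mem_row0] at hb
            obtain ⟨j, _, rfl⟩ := hb
            omega
        simp only [row, List.mem_map, mem_row0] at hmem
        obtain ⟨j, ⟨hj, hj1⟩, rfl⟩ := hmem
        by_contra hlt
        have := first j (by omega)
        rw [Nat.zero_add] at this
        omega
      refine ch_cons' (s := (2 * (q - 1) + 1) :: (row (n + 1) T0 1).tail) ?_ ?_ ?_ ?_
      · refine List.Sublist.trans ?_ (RA_sublist (show q ≤ n + 1 by omega) 1)
        obtain ⟨q', rfl⟩ := Nat.exists_eq_add_of_le' (show 1 ≤ q by omega)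
        rw [RA_succ']
        have : [2 * (q' + 1 - 1) + 1].Sublist (row (n + 1) T0 (1 + q')) := by
          rw [List.singleton_sublist]
          simp only [row, List.mem_map, mem_row0]
          have := first q' (by omega)
          rw [Nat.zero_add] at this
          exact ⟨q', ⟨by omega, by omega⟩, by omega⟩
        exact this.append ((List.tail_sublist _).trans (row1_sublist (by omega)))
      · rw [List.pairwise_cons]
        exact ⟨fun x hx => by have := htail x hx; omega,
          (row_sorted _ _ _).sublist (List.tail_sublist _)⟩
      · simp [row_length, c1]
      · intro x hx
        rcases List.mem_cons.1 hx with rfl | hx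
        · omega
        · have := htail x hx; omega
  · intro T hT he
    have hTT : ∀ j < n, T j = T0 j := by
      intro j hj
      rw [← he, ext_lt hj]
    rcases (hT.2.2 m).1 with h | h
    · rcases ch_snoc h with h | ⟨s, s1, s2, s3, s4⟩
      · exact hT.2.1.1 h
      · have := inc_le hT.1.2 s1 s2 (m := m) s4
        rw [cnt_congr (T' := T1) (fun i hi => by
          rw [hTT i (by omega), hT0, blk_lt hi]), t3] at this
        omega
    · rcases ch_snoc h with h | ⟨s, s1, s2, s3, s4⟩
      · exact hT.2.1.2 h
      · have := dec_le s1 s2 (q := q - 1) (by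
          intro x hx
          have hx2 := s4 x hx
          obtain ⟨j, hj, rfl, hj1, -⟩ := mem_RA.1 (s1.subset hx)
          have e1 : (2 * j + 1) / 2 = j := by omega
          have := last (j - m) (by omega)
          rw [show m + (j - m) = j by omega] at this
          rw [e1, hTT j hj]
          omega)
        omega

theorem gp_lt {q a n : ℕ} (hq : 2 ≤ q) (h1 : a + 2 * q ≤ n + 1) (h2 : n < (a + 2) * q)
    [Finite (GP (a + 3) (q + 1) (n + 1))] :
    Nat.card (GP (a + 3) (q + 1) n) < Nat.card (GP (a + 3) (q + 1) (n + 1)) := by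
  have hinj := gpExt_inj (p := a + 2) (q := q) (by omega) (by omega) h2
  obtain ⟨T0, g, hT0⟩ := exists_special hq h1 h2
  have : Finite (GP (a + 3) (q + 1) n) := Finite.of_injective _ hinj
  have := Fintype.ofFinite (GP (a + 3) (q + 1) n)
  have := Fintype.ofFinite (GP (a + 3) (q + 1) (n + 1))
  rw [Nat.card_eq_fintype_card, Nat.card_eq_fintype_card]
  refine Fintype.card_lt_of_injective_of_notMem
    (gpExt (p := a + 2) (q := q) (by omega) (by omega) h2) hinj
    (b := ⟨(T0, T0), g, g, fun _ _ => rfl⟩) ?_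
  rintro ⟨x, hx⟩
  exact hT0 x.1.1 x.2.1 (congrArg (fun y => y.1.1) hx)

end QC
namespace QC

structure Grid (X : ℕ → ℕ → Prop) (V H : ℕ → ℕ → ℕ) (n : ℕ) : Prop where
  v0 : ∀ j < n, V 0 j = 0
  h0 : ∀ i < n, H i 0 = 0
  cell : ∀ i < n, ∀ j < n, Cell (X i j) (V i j) (H i j) (V (i + 1) j) (H i (j + 1))

theorem Cell.swap {x : Prop} {v h v' h' : ℕ} (c : Cell x v h v' h') : Cell x h v h' v' := by
  unfold Cell at *
  rcases c with ⟨a, b, c, d⟩ | ⟨a, b, c⟩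
  · exact Or.inl ⟨a.symm, by rwa [← a], d, c⟩
  · refine Or.inr ⟨fun h => a ⟨h.1.symm, ?_⟩, c, b⟩
    rw [← h.1]; exact h.2

theorem Grid.swap {X : ℕ → ℕ → Prop} {V H : ℕ → ℕ → ℕ} {n : ℕ} (g : Grid X V H n) :
    Grid (fun i j => X j i) (fun i j => H j i) (fun i j => V j i) n :=
  ⟨g.h0, g.v0, fun i hi j hj => (g.cell j hj i hi).swap⟩

theorem cell_det {x y : Prop} (hxy : x ↔ y) {v h v1 h1 v2 h2 : ℕ} (c : Cell x v h v1 h1)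
    (d : Cell y v h v2 h2) : v1 = v2 ∧ h1 = h2 := by
  rw [propext hxy] at c
  unfold Cell at *
  rcases c with ⟨a, b, c⟩ | ⟨a, c⟩ <;> rcases d with ⟨a', b', d⟩ | ⟨a', d⟩
  · omega
  · exact absurd ⟨a, b⟩ a'
  · exact absurd ⟨a', b'⟩ a
  · omega

theorem grid_unique {X X' : ℕ → ℕ → Prop} {V H V' H' : ℕ → ℕ → ℕ} {n : ℕ}
    (hX : ∀ i < n, ∀ j < n, (X i j ↔ X' i j)) (g : Grid X V H n) (g' : Grid X' V' H' n) :
    (∀ i ≤ n, ∀ j < n, V i j = V' i j) ∧ (∀ i < n, ∀ j ≤ n, H i j = H' i j) := by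
  have step : ∀ i < n, (∀ j < n, V i j = V' i j) → ∀ j ≤ n, H i j = H' i j := by
    intro i hi hV j
    induction j with
    | zero => intro _; rw [g.h0 i hi, g'.h0 i hi]
    | succ j ih =>
      intro hj
      have c := g.cell i hi j hj
      have d := g'.cell i hi j hj
      rw [hV j hj, ih (by omega)] at c
      exact (cell_det (hX i hi j hj) c d).2
  have hV : ∀ i ≤ n, ∀ j < n, V i j = V' i j := by
    intro i
    induction i with
    | zero => intro _ j hj; rw [g.v0 j hj, g'.v0 j hj]
    | succ i ih =>
      intro hi j hj
      have c := g.cell i hi j hj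
      have d := g'.cell i hi j hj
      rw [ih (by omega) j hj, step i hi (ih (by omega)) j hj.le] at c
      exact (cell_det (hX i hi j hj) c d).1
  exact ⟨hV, fun i hi => step i hi (hV i hi.le)⟩

open Classical in
noncomputable def fH (x : ℕ → Prop) (V : ℕ → ℕ) : ℕ → ℕ
  | 0 => 0
  | j + 1 => if V j = fH x V j ∧ (V j ≠ 0 ∨ x j) then fH x V j + 1 else fH x V j

open Classical in
noncomputable def fV (X : ℕ → ℕ → Prop) : ℕ → ℕ → ℕ
  | 0 => fun _ => 0
  | i + 1 => fun j => if fV X i j = fH (X i) (fV X i) j ∧ (fV X i j ≠ 0 ∨ X i j)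
      then fV X i j + 1 else fV X i j

theorem exists_grid (X : ℕ → ℕ → Prop) :
    (∀ n, Grid X (fV X) (fun i j => fH (X i) (fV X i) j) n) := by
  intro n
  refine ⟨fun j _ => rfl, fun i _ => rfl, fun i _ j _ => ?_⟩
  show Cell _ _ _ (fV X (i+1) j) (fH (X i) (fV X i) (j+1))
  unfold Cell
  rw [fV, fH]
  beta_reduce
  by_cases h : fV X i j = fH (X i) (fV X i) j ∧ (fV X i j ≠ 0 ∨ X i j)
  · left
    rw [if_pos h, if_pos h]
    exact ⟨h.1, h.2, rfl, rfl⟩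
  · right
    rw [if_neg h, if_neg h]
    exact ⟨h, rfl, rfl⟩

section full
variable {X : ℕ → ℕ → Prop} {V H : ℕ → ℕ → ℕ}

theorem V_pos {n : ℕ} (g : Grid X V H n) (hX : ∀ i i' j, X i j → X i' j → i = i')
    (hX' : ∀ i j j', X i j → X i j' → j = j') :
    ∀ s, ∀ i < n, ∀ j < n, i + j < s → (V i j = 0 ↔ ∀ i' < i, ¬ X i' j) ∧
      (H i j = 0 ↔ ∀ j' < j, ¬ X i j') := by
  intro s
  induction s with
  | zero => intro i _ j _ h; omega
  | succ s ih =>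
    intro i hi j hj hs
    constructor
    · rcases i with _ | i
      · simp [g.v0 j hj]
      · have a := ih i (by omega) j hj (by omega)
        have c := g.cell i (by omega) j hj
        by_cases x : X i j
        · have h1 : V i j = 0 := a.1.2 fun i' h' hx => by
            have := hX _ _ _ x hx; omega
          have h2 : H i j = 0 := a.2.2 fun i' h' hx => by
            have := hX' _ _ _ x hx; omega
          have : V (i + 1) j ≠ 0 := by
            unfold Cell at c
            rcases c with c | c
            · omega
            · exact absurd ⟨by omega, Or.inr x⟩ c.1
          constructor
          · intro h; omega
          · intro h; exact absurd x (h i (by omega))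
        · have : V (i + 1) j = 0 ↔ V i j = 0 := by
            unfold Cell at c
            rcases c with ⟨c1, c2 | c2, c3⟩ | c
            · omega
            · exact absurd c2 x
            · omega
          rw [this, a.1]
          constructor
          · intro h i' hi'
            rcases Nat.lt_succ_iff_lt_or_eq.1 hi' with h' | h'
            · exact h i' h'
            · rw [h']; exact x
          · intro h i' hi'; exact h i' (by omega)
    · rcases j with _ | j
      · simp [g.h0 i hi]
      · have a := ih i (by omega) j (by omega) (by omega)
        have c := g.cell i (by omega) j (by omega)
        by_cases x : X i j
        · have h1 : V i j = 0 := a.1.2 fun i' h' hx => by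
            have := hX _ _ _ x hx; omega
          have h2 : H i j = 0 := a.2.2 fun i' h' hx => by
            have := hX' _ _ _ x hx; omega
          have : H i (j + 1) ≠ 0 := by
            unfold Cell at c
            rcases c with c | c
            · omega
            · exact absurd ⟨by omega, Or.inr x⟩ c.1
          constructor
          · intro h; omega
          · intro h; exact absurd x (h j (by omega))
        · have : H i (j + 1) = 0 ↔ H i j = 0 := by
            unfold Cell at c
            rcases c with ⟨c1, c2 | c2, c3⟩ | c
            · omega
            · exact absurd c2 x
            · omega
          rw [this, a.2]
          constructor
          · intro h i' hi'
            rcases Nat.lt_succ_iff_lt_or_eq.1 hi' with h' | h'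
            · exact h i' h'
            · rw [h']; exact x
          · intro h i' hi'; exact h i' (by omega)

theorem V_pos' (g : ∀ n, Grid X V H n) (hX : ∀ i i' j, X i j → X i' j → i = i')
    (hX' : ∀ i j j', X i j → X i j' → j = j') (i j : ℕ) :
    (V i j = 0 ↔ ∀ i' < i, ¬ X i' j) ∧ (H i j = 0 ↔ ∀ j' < j, ¬ X i j') :=
  V_pos (g (i + j + 1)) hX hX' (i + j + 1) i (by omega) j (by omega) (by omega)

theorem V_le (g : ∀ n, Grid X V H n) (i j : ℕ) : V i j ≤ i := by
  induction i with
  | zero => rw [(g (j + 1)).v0 j (by omega)]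
  | succ i ih =>
    have c := (g (i + j + 1)).cell i (by omega) j (by omega)
    unfold Cell at c
    omega

theorem shape_eq (g : ∀ n, Grid X V H n) {r : ℕ} (hr : 1 ≤ r) : ∀ i j,
    cnt (V i) j r = cnt (fun i => H i j) i r := by
  intro i
  induction i with
  | zero =>
    intro j
    induction j with
    | zero => rw [cnt_zero, cnt_zero]
    | succ j ih =>
      rw [cnt_succ, ih, cnt_zero, cnt_zero, (g (j + 1)).v0 j (by omega), if_neg (by omega)]
  | succ i ihi =>
    intro j
    induction j with
    | zero =>
      have := ihi 0
      rw [cnt_zero] at *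
      rw [cnt_succ, ← this, (g (i + 1)).h0 i (by omega), if_neg (by omega)]
    | succ j ihj =>
      have h1 := ihi (j + 1)
      have h2 := ihi j
      rw [cnt_succ] at h1 ihj ⊢
      rw [cnt_succ, ← h1]
      have c := (g (i + j + 1)).cell i (by omega) j (by omega)
      unfold Cell at c
      rcases c with c | c
      · split_ifs at * <;> omega
      · split_ifs at * <;> omega

theorem shape_latt (g : ∀ n, Grid X V H n) : ∀ i, Latt (V i) := by
  intro i
  induction i with
  | zero =>
    intro j r hr
    rw [shape_eq g (by omega), shape_eq g hr, cnt_zero, cnt_zero]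
  | succ i ihi =>
    intro j
    induction j with
    | zero => intro r _; rw [cnt_zero, cnt_zero]
    | succ j ihj =>
      intro r hr
      have h0 := ihi j r hr
      have h1 := ihi (j + 1) r hr
      have h2 := ihj r hr
      have e1 := shape_eq g hr (i + 1) j
      have e2 := shape_eq g (show 1 ≤ r + 1 by omega) (i + 1) j
      rw [cnt_succ, ← shape_eq g hr] at e1
      rw [cnt_succ, ← shape_eq g (by omega)] at e2
      rw [e1, e2] at h2
      rw [cnt_succ, cnt_succ] at h1
      rw [cnt_succ, cnt_succ, e1, e2]
      have c := (g (i + j + 1)).cell i (by omega) j (by omega)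
      unfold Cell at c
      clear e1 e2
      rcases c with ⟨c1, _, c3, c4⟩ | ⟨c1, c2, c3⟩
      · split_ifs at * <;> omega
      · have : V i j ≠ H i j ∨ V i j = 0 := by
          by_contra hh
          push Not at hh
          exact c1 ⟨hh.1, Or.inl hh.2⟩
        clear c1
        split_ifs at * <;> omega

end full

end QC
namespace QC

def XP {n : ℕ} (σ : Equiv.Perm (Fin n)) (i j : ℕ) : Prop := ∃ h : i < n, (σ ⟨i, h⟩ : ℕ) = j

theorem XP_col {n : ℕ} (σ : Equiv.Perm (Fin n)) : ∀ i i' j, XP σ i j → XP σ i' j → i = i' := by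
  rintro i i' j ⟨h, e⟩ ⟨h', e'⟩
  have : σ ⟨i, h⟩ = σ ⟨i', h'⟩ := Fin.ext (e.trans e'.symm)
  simpa using σ.injective this

theorem XP_row {n : ℕ} (σ : Equiv.Perm (Fin n)) : ∀ i j j', XP σ i j → XP σ i j' → j = j' := by
  rintro i j j' ⟨h, e⟩ ⟨h', e'⟩
  exact e.symm.trans e'

theorem XP_inv {n : ℕ} (σ : Equiv.Perm (Fin n)) (i j : ℕ) : XP σ⁻¹ i j ↔ XP σ j i := by
  constructor
  · rintro ⟨h, rfl⟩
    exact ⟨(σ⁻¹ ⟨i, h⟩).2, by simp⟩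
  · rintro ⟨h, rfl⟩
    exact ⟨(σ ⟨j, h⟩).2, by simp⟩

noncomputable def gV {n : ℕ} (σ : Equiv.Perm (Fin n)) : ℕ → ℕ → ℕ := fV (XP σ)
noncomputable def gH {n : ℕ} (σ : Equiv.Perm (Fin n)) : ℕ → ℕ → ℕ :=
  fun i j => fH (XP σ i) (fV (XP σ) i) j

theorem gG {n : ℕ} (σ : Equiv.Perm (Fin n)) (N : ℕ) : Grid (XP σ) (gV σ) (gH σ) N :=
  exists_grid (XP σ) N

noncomputable def P {n : ℕ} (σ : Equiv.Perm (Fin n)) : ℕ → ℕ := gV σ n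

theorem P_tab {n : ℕ} (σ : Equiv.Perm (Fin n)) : IsTab n (P σ) := by
  refine ⟨fun j => ?_, shape_latt (gG σ) n⟩
  unfold P
  rw [(V_pos' (gG σ) (XP_col σ) (XP_row σ) n j).1]
  constructor
  · intro h
    by_contra hj
    push Not at hj
    refine h (σ⁻¹ ⟨j, hj⟩) (σ⁻¹ ⟨j, hj⟩).2 ⟨(σ⁻¹ ⟨j, hj⟩).2, by simp⟩
  · rintro hj i' hi' ⟨h, e⟩
    have := (σ ⟨i', h⟩).2
    omega

theorem P_inv {n : ℕ} (σ : Equiv.Perm (Fin n)) (i : ℕ) : P σ⁻¹ i = gH σ i n := by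
  have := grid_unique (X := XP σ⁻¹) (X' := fun i j => XP σ j i) (fun i _ j _ => XP_inv σ i j)
    (gG σ⁻¹ (n + i + 1)) (gG σ (n + i + 1)).swap
  exact this.1 n (by omega) i (by omega)

theorem P_shape {n : ℕ} (σ : Equiv.Perm (Fin n)) {r : ℕ} (hr : 1 ≤ r) :
    cnt (P σ) n r = cnt (P σ⁻¹) n r := by
  unfold P
  rw [shape_eq (gG σ) hr]
  exact cnt_congr (fun i _ => (P_inv σ i).symm) r

def W {n : ℕ} (σ : Equiv.Perm (Fin n)) : List ℕ := List.ofFn (fun i => 2 * (σ i : ℕ) + 1)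

theorem W_eqv {n : ℕ} (σ : Equiv.Perm (Fin n)) : Eqv (W σ) (read n (P σ)) := by
  have key : ∀ i ≤ n, Eqv ((W σ).take i) (read n (gV σ i)) := by
    intro i
    induction i with
    | zero =>
      intro _
      have : read n (gV σ 0) = [] := by
        apply List.eq_nil_iff_forall_not_mem.2
        intro x hx
        unfold read at hx
        rw [mem_RA] at hx
        obtain ⟨j, hj⟩ := hx
        have : gV σ 0 j = 0 := rfl
        omega
      rw [this]
      exact Eqv.refl _
    | succ i ih =>
      intro hi
      have ih := ih (by omega)
      have e : (W σ).take (i + 1) = (W σ).take i ++ [2 * (σ ⟨i, hi⟩ : ℕ) + 1] := by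
        rw [List.take_succ_eq_append_getElem (by simpa [W] using hi)]
        simp [W]
      rw [e]
      refine (ih.right _).trans ?_
      have x : XP σ i (σ ⟨i, hi⟩) := ⟨hi, rfl⟩
      have c := (gG σ n).cell i hi _ (σ ⟨i, hi⟩).2
      have v0 : gV σ i (σ ⟨i, hi⟩) = 0 :=
        (V_pos' (gG σ) (XP_col σ) (XP_row σ) i _).1.2 fun i' h' hx => by
          have := XP_col σ _ _ _ x hx; omega
      have h0 : gH σ i (σ ⟨i, hi⟩) = 0 :=
        (V_pos' (gG σ) (XP_col σ) (XP_row σ) i _).2.2 fun i' h' hx => by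
          have := XP_row σ _ _ _ x hx; omega
      refine col_knuth (x := XP σ i) (H := gH σ i) ((gG σ n).cell i hi) n 1 _ le_rfl
        (σ ⟨i, hi⟩).2 h0 ?_ ?_
      · unfold Cell at c
        rcases c with c | c
        · omega
        · exact absurd ⟨by omega, Or.inr x⟩ c.1
      · intro j _
        have := V_le (gG σ) (i + 1) j
        omega
  have := key n le_rfl
  rwa [List.take_of_length_le (by simp [W])] at this

theorem P_inj {n : ℕ} {σ τ : Equiv.Perm (Fin n)} (h : P σ = P τ) (h' : P σ⁻¹ = P τ⁻¹) : σ = τ := by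
  have step : ∀ i < n, (∀ j < n, gV σ (i + 1) j = gV τ (i + 1) j) → ∀ d ≤ n,
      gH σ i (n - d) = gH τ i (n - d) ∧ (1 ≤ d → gV σ i (n - d) = gV τ i (n - d)) := by
    intro i hi hV d
    induction d with
    | zero =>
      intro _
      refine ⟨?_, by omega⟩
      rw [Nat.sub_zero, ← P_inv, ← P_inv, h']
    | succ d ih =>
      intro hd
      have a := (ih (by omega)).1
      have hj := hV (n - (d + 1)) (by omega)
      have c := (gG σ n).cell i hi (n - (d + 1)) (by omega)
      have c' := (gG τ n).cell i hi (n - (d + 1)) (by omega)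
      rw [show n - (d + 1) + 1 = n - d by omega] at c c'
      unfold Cell at c c'
      rcases c with ⟨c1, c2, c3⟩ | ⟨c1, c2⟩ <;> rcases c' with ⟨d1, d2, d3⟩ | ⟨d1, d2⟩
      · omega
      · exact absurd ⟨by omega, Or.inl (by omega)⟩ d1
      · exact absurd ⟨by omega, Or.inl (by omega)⟩ c1
      · omega
  have hV : ∀ d ≤ n, ∀ j < n, gV σ (n - d) j = gV τ (n - d) j := by
    intro d
    induction d with
    | zero => intro _ j _; exact congrFun h j
    | succ d ih =>
      intro hd j hj
      have := step (n - (d + 1)) (by omega)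
        (by rw [show n - (d + 1) + 1 = n - d by omega]; exact ih (by omega)) (n - j) (by omega)
      rw [show n - (n - j) = j by omega] at this
      exact this.2 (by omega)
  ext ⟨i, hi⟩
  have x : XP σ i (σ ⟨i, hi⟩) := ⟨hi, rfl⟩
  have hj := (σ ⟨i, hi⟩).2
  generalize (σ ⟨i, hi⟩ : ℕ) = j at x hj
  have hv1 := hV (n - i) (by omega) j hj
  have hv2 := hV (n - (i + 1)) (by omega) j hj
  rw [show n - (n - i) = i by omega] at hv1
  have a1 := V_pos' (gG σ) (XP_col σ) (XP_row σ) i j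
  have a2 := V_pos' (gG σ) (XP_col σ) (XP_row σ) (i + 1) j
  have b1 := V_pos' (gG τ) (XP_col τ) (XP_row τ) i j
  have b2 := V_pos' (gG τ) (XP_col τ) (XP_row τ) (i + 1) j
  have hv3 : gV σ (i + 1) j = gV τ (i + 1) j := by
    have := hV (n - (i + 1)) (by omega) j hj
    rwa [show n - (n - (i + 1)) = i + 1 by omega] at this
  have z : gV σ i j = 0 := a1.1.2 fun i' h' hx => by
    have := XP_col σ _ _ _ x hx; omega
  rw [hv1] at z
  have nz : gV σ (i + 1) j ≠ 0 := fun e => a2.1.1 e i (by omega) x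
  rw [hv3] at nz
  have := mt b2.1.2 nz
  push Not at this
  obtain ⟨i', hi', hx⟩ := this
  have : i' = i := by
    by_contra hne
    exact b1.1.1 z i' (by omega) hx
  subst this
  exact hx.2.symm

end QC
namespace QC

def BC (v h v' h' : ℕ) : Prop :=
  (v' = h' ∧ v = v' - 1 ∧ h = h' - 1) ∨ (v' ≠ h' ∧ v = v' ∧ h = h')

theorem bc_ex (v' h' : ℕ) : ∃ v h, BC v h v' h' := by
  by_cases e : v' = h'
  · exact ⟨_, _, Or.inl ⟨e, rfl, rfl⟩⟩
  · exact ⟨_, _, Or.inr ⟨e, rfl, rfl⟩⟩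

theorem col_back (V' : ℕ → ℕ) : ∀ n q, ∃ V H : ℕ → ℕ, H n = q ∧
    ∀ j < n, BC (V j) (H j) (V' j) (H (j + 1)) := by
  intro n
  induction n with
  | zero => intro q; exact ⟨fun _ => 0, fun _ => q, rfl, by omega⟩
  | succ n ih =>
    intro q
    obtain ⟨v, h, b⟩ := bc_ex (V' n) q
    obtain ⟨V, H, h1, h2⟩ := ih h
    refine ⟨Function.update V n v, Function.update H (n + 1) q, by simp, ?_⟩
    intro j hj
    by_cases e : j = n
    · subst e
      simpa [h1] using b
    · rw [Function.update_of_ne e, Function.update_of_ne (by omega),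
        Function.update_of_ne (by omega)]
      exact h2 j (by omega)

theorem grid_back (n : ℕ) (Q : ℕ → ℕ) : ∀ m (T : ℕ → ℕ), ∃ V H : ℕ → ℕ → ℕ, V m = T ∧
    (∀ i < m, H i n = Q i) ∧ ∀ i < m, ∀ j < n, BC (V i j) (H i j) (V (i + 1) j) (H i (j + 1)) := by
  intro m
  induction m with
  | zero => intro T; exact ⟨fun _ => T, fun _ _ => 0, rfl, by omega, by omega⟩
  | succ m ih =>
    intro T
    obtain ⟨V0, H0, a1, a2⟩ := col_back T n (Q m)
    obtain ⟨V, H, h1, h2, h3⟩ := ih V0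
    refine ⟨Function.update V (m + 1) T, Function.update H m H0, by simp, ?_, ?_⟩
    · intro i hi
      by_cases e : i = m
      · subst e; simpa using a1
      · rw [Function.update_of_ne e]; exact h2 i (by omega)
    · intro i hi j hj
      by_cases e : i = m
      · subst e
        simpa [h1] using a2 j hj
      · rw [Function.update_of_ne e, Function.update_of_ne (by omega),
          Function.update_of_ne (by omega)]
        exact h3 i (by omega) j hj

theorem down_ind {n : ℕ} {p : ℕ → Prop} (h0 : p n) (h : ∀ j < n, p (j + 1) → p j) :
    ∀ j ≤ n, p j := by
  intro j hj
  exact Nat.decreasingInduction (motive := fun j _ => p j) (fun k hk => h k hk) h0 hj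

section back
variable {n : ℕ} {V H : ℕ → ℕ → ℕ}

def lam (n : ℕ) (V H : ℕ → ℕ → ℕ) (i j r : ℕ) : ℤ :=
  (cnt (fun i => H i n) i r : ℤ) + cnt (V i) j r - cnt (V i) n r

def ind (a r : ℕ) : ℤ := if a = r then 1 else 0

theorem ind_nn (a r : ℕ) : 0 ≤ ind a r := by unfold ind; split_ifs <;> omega

theorem lam_h (i j r : ℕ) : lam n V H i (j + 1) r = lam n V H i j r + ind (V i j) r := by
  unfold lam ind
  rw [cnt_succ]
  push_cast
  ring

theorem lam_v (hb : ∀ i < n, ∀ j < n, BC (V i j) (H i j) (V (i + 1) j) (H i (j + 1)))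
    {r : ℕ} (hr : 1 ≤ r) {i : ℕ} (hi : i < n) : ∀ j ≤ n,
    lam n V H (i + 1) j r = lam n V H i j r + ind (H i j) r := by
  apply down_ind
  · unfold lam ind
    rw [cnt_succ]
    push_cast
    ring
  · intro j hj ih
    rw [lam_h, lam_h] at ih
    have b := hb i hi j hj
    unfold BC at b
    unfold ind at *
    split_ifs at * <;> omega

theorem lam_part (hb : ∀ i < n, ∀ j < n, BC (V i j) (H i j) (V (i + 1) j) (H i (j + 1)))
    (hP : Latt (V n)) (hQ : Latt (fun i => H i n))
    (he : ∀ r, 1 ≤ r → cnt (V n) n r = cnt (fun i => H i n) n r) :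
    ∀ i ≤ n, ∀ j ≤ n, ∀ r, 1 ≤ r → 0 ≤ lam n V H i j r ∧
      lam n V H i j (r + 1) ≤ lam n V H i j r := by
  apply down_ind
  · intro j hj r hr
    have h1 := he r hr
    have h2 := he (r + 1) (by omega)
    have h3 := hP j r hr
    unfold lam
    rw [← h1, ← h2]
    omega
  · intro i hi ihi
    apply down_ind
    · intro r hr
      have := hQ i r hr
      unfold lam
      omega
    · intro j hj ihj r hr
      have a1 := ihi (j + 1) (by omega) r hr
      have a2 := ihi j (by omega) r hr
      have a3 := ihj r hr
      have a1' := ihi (j + 1) (by omega) (r + 1) (by omega)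
      have a2' := ihi j (by omega) (r + 1) (by omega)
      have a3' := ihj (r + 1) (by omega)
      have e1 := lam_h (n := n) (V := V) (H := H) i j r
      have e2 := lam_h (n := n) (V := V) (H := H) i j (r + 1)
      have e3 := lam_v hb hr hi j (by omega)
      have e4 := lam_v hb (show 1 ≤ r + 1 by omega) hi j (by omega)
      have e5 := lam_h (n := n) (V := V) (H := H) (i + 1) j r
      have e6 := lam_h (n := n) (V := V) (H := H) (i + 1) j (r + 1)
      have b := hb i hi j hj
      unfold BC at b
      unfold ind at *
      split_ifs at * <;> omega

end back

theorem P_surj {n : ℕ} {T T' : ℕ → ℕ} (hT : IsTab n T) (hT' : IsTab n T')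
    (he : ∀ r, 1 ≤ r → cnt T n r = cnt T' n r) :
    ∃ σ : Equiv.Perm (Fin n), P σ = T ∧ P σ⁻¹ = T' := by
  obtain ⟨V, H0, h1, h2, hb0⟩ := grid_back n T' n T
  -- normalise `H` outside the range
  obtain ⟨H, hHn, hb⟩ : ∃ H : ℕ → ℕ → ℕ, (∀ i, H i n = T' i) ∧
      ∀ i < n, ∀ j < n, BC (V i j) (H i j) (V (i + 1) j) (H i (j + 1)) := by
    refine ⟨fun i j => if i < n then H0 i j else T' i, ?_, ?_⟩
    · intro i
      by_cases h : i < n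
      · simp [h, h2 i h]
      · simp [h]
    · intro i hi j hj
      simpa [hi] using hb0 i hi j hj
  have hHn' : (fun i => H i n) = T' := funext hHn
  have lp := lam_part hb (by rw [h1]; exact hT.2) (by rw [hHn']; exact hT'.2)
    (by rw [h1, hHn']; exact he)
  have ind1 : ∀ a, (∀ r, 1 ≤ r → ind a r = 0) → a = 0 := by
    intro a h
    by_contra hne
    have := h a (by omega)
    simp [ind] at this
  have z1 : ∀ j ≤ n, ∀ r, 1 ≤ r → lam n V H 0 j r = 0 := by
    apply down_ind
    · intro r hr
      unfold lam
      rw [cnt_zero]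
      simp
    · intro j hj ih r hr
      have := ih r hr
      rw [lam_h] at this
      have := ind_nn (V 0 j) r
      have := (lp 0 (by omega) j hj.le r hr).1
      omega
  have v0 : ∀ j < n, V 0 j = 0 := by
    intro j hj
    apply ind1
    intro r hr
    have a := z1 (j + 1) hj r hr
    rw [lam_h, z1 j hj.le r hr] at a
    omega
  have z2 : ∀ i ≤ n, ∀ r, 1 ≤ r → lam n V H i 0 r = 0 := by
    apply down_ind
    · intro r hr
      unfold lam
      rw [cnt_zero, h1, hHn', he r hr]
      simp
    · intro j hj ih r hr
      have := ih r hr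
      rw [lam_v hb hr hj 0 (by omega)] at this
      have := ind_nn (H j 0) r
      have := (lp j (by omega) 0 (by omega) r hr).1
      omega
  have h0 : ∀ i < n, H i 0 = 0 := by
    intro i hi
    apply ind1
    intro r hr
    have a := z2 (i + 1) hi r hr
    rw [lam_v hb hr hi 0 (by omega), z2 i hi.le r hr] at a
    omega
  let X : ℕ → ℕ → Prop := fun i j => V i j = 0 ∧ H i j = 0 ∧ V (i + 1) j = 1 ∧ H i (j + 1) = 1
  have hc : ∀ i < n, ∀ j < n, Cell (X i j) (V i j) (H i j) (V (i + 1) j) (H i (j + 1)) := by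
    intro i hi j hj
    have b := hb i hi j hj
    unfold BC at b
    unfold Cell
    show (_ ∧ (_ ∨ (V i j = 0 ∧ H i j = 0 ∧ V (i + 1) j = 1 ∧ H i (j + 1) = 1)) ∧ _) ∨
      (¬ (_ ∧ (_ ∨ (V i j = 0 ∧ H i j = 0 ∧ V (i + 1) j = 1 ∧ H i (j + 1) = 1))) ∧ _)
    omega
  have g : Grid X V H n := ⟨v0, h0, hc⟩
  have hrow : ∀ i < n, ∃ j < n, X i j := by
    intro i hi
    by_contra hno
    push Not at hno
    have : ∀ j ≤ n, H i j = 0 := by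
      intro j
      induction j with
      | zero => intro _; exact h0 i hi
      | succ j ih =>
        intro hj
        have a := ih (by omega)
        have c := hc i hi j hj
        have x := hno j hj
        unfold Cell at c
        rcases c with ⟨c1, c2 | c2, c3⟩ | c
        · omega
        · exact absurd c2 x
        · omega
    have a := this n le_rfl
    rw [hHn] at a
    have := (hT'.1 i).1 a
    omega
  have hrow' : ∀ i < n, ∀ j < n, ∀ j' < n, X i j → X i j' → ¬ j < j' := by
    intro i hi j hj j' hj' x x' hlt
    have := H_mono (hc i hi) (show j + 1 ≤ j' from hlt) (by omega)
    have := x.2.2.2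
    have := x'.2.1
    omega
  have hcol' : ∀ j < n, ∀ i < n, ∀ i' < n, X i j → X i' j → ¬ i < i' := by
    intro j hj i hi i' hi' x x' hlt
    have := H_mono (g.swap.cell j hj) (show i + 1 ≤ i' from hlt) (by omega)
    have := x.2.2.1
    have := x'.1
    omega
  choose s hs hsX using hrow
  let f : Fin n → Fin n := fun i => ⟨s i i.2, hs i i.2⟩
  have finj : Function.Injective f := by
    intro a b hab
    have e : s a a.2 = s b b.2 := congrArg Fin.val hab
    have xa := hsX a a.2
    have xb := hsX b b.2
    rw [e] at xa
    have k1 := hcol' _ (hs b b.2) a a.2 b b.2 xa xb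
    have k2 := hcol' _ (hs b b.2) b b.2 a a.2 xb xa
    exact Fin.ext (by omega)
  let σ : Equiv.Perm (Fin n) := Equiv.ofBijective f (Finite.injective_iff_bijective.1 finj)
  have hXX : ∀ i < n, ∀ j < n, (XP σ i j ↔ X i j) := by
    intro i hi j hj
    constructor
    · rintro ⟨h, e⟩
      have e : s i h = j := e
      rw [← e]
      exact hsX i h
    · intro x
      refine ⟨hi, ?_⟩
      show s i hi = j
      have k1 := hrow' i hi _ (hs i hi) j hj (hsX i hi) x
      have k2 := hrow' i hi j hj _ (hs i hi) x (hsX i hi)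
      omega
  have u := grid_unique hXX (gG σ n) g
  refine ⟨σ, ?_, ?_⟩
  · funext j
    by_cases hj : j < n
    · rw [← h1]; exact u.1 n le_rfl j hj
    · rw [((P_tab σ).1 j).2 (by omega), (hT.1 j).2 (by omega)]
  · funext j
    by_cases hj : j < n
    · rw [P_inv, ← hHn]; exact u.2 j hj n le_rfl
    · rw [((P_tab σ⁻¹).1 j).2 (by omega), (hT'.1 j).2 (by omega)]

end QC
namespace QC

theorem ch_ofFn {R : ℕ → ℕ → Prop} {p n : ℕ} (w : Fin n → ℕ) :
    Ch R p (List.ofFn w) ↔ ∃ f : Fin p → Fin n, StrictMono f ∧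
      ∀ a b, a < b → R (w (f a)) (w (f b)) := by
  constructor
  · rintro ⟨s, h1, h2, rfl⟩
    rw [List.sublist_iff_exists_fin_orderEmbedding_get_eq] at h1
    obtain ⟨f, hf⟩ := h1
    refine ⟨fun a => Fin.cast (by simp) (f a), ?_, ?_⟩
    · intro a b hab
      have := f.strictMono hab
      exact this
    · intro a b hab
      have h := List.pairwise_iff_get.1 h2 a b hab
      rw [hf a, hf b, List.get_ofFn, List.get_ofFn] at h
      exact h
  · rintro ⟨f, h1, h2⟩
    refine ⟨List.ofFn (w ∘ f), ?_, ?_, by simp⟩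
    · rw [List.sublist_iff_exists_fin_orderEmbedding_get_eq]
      refine ⟨OrderEmbedding.ofStrictMono
        (fun a => Fin.cast (by simp) (f (Fin.cast (by simp) a))) ?_, ?_⟩
      · intro a b hab
        exact h1 (show Fin.cast (by simp) a < Fin.cast (by simp) b from hab)
      · intro a
        rw [List.get_ofFn, List.get_ofFn]
        rfl
    · rw [List.pairwise_ofFn]
      intro a b hab
      exact h2 a b hab

theorem ch_incr {k n : ℕ} (w : Fin n → ℕ) (τ : Fin n → Fin n)
    (h : ∀ a b, τ a < τ b ↔ w a < w b) : Ch (· < ·) k (List.ofFn w) ↔ HasIncr k n τ := by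
  rw [ch_ofFn]
  unfold HasIncr
  refine exists_congr fun f => and_congr_right fun _ => ?_
  constructor
  · intro hh a b hab; exact (h _ _).2 (hh a b hab)
  · intro hh a b hab; exact (h _ _).1 (hh hab)

theorem ch_decr {k n : ℕ} (w : Fin n → ℕ) (τ : Fin n → Fin n)
    (h : ∀ a b, τ a < τ b ↔ w a < w b) : Ch (· > ·) k (List.ofFn w) ↔ HasDecr k n τ := by
  rw [ch_ofFn]
  unfold HasDecr
  refine exists_congr fun f => and_congr_right fun _ => ?_
  constructor
  · intro hh a b hab; exact (h _ _).2 (hh a b hab)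
  · intro hh a b hab; exact (h _ _).1 (hh hab)

theorem sa_val {n : ℕ} (i : Fin (n + 1)) (x : Fin n) :
    (i.succAbove x : ℕ) = if (x : ℕ) < i then (x : ℕ) else x + 1 := by
  unfold Fin.succAbove
  simp only [Fin.lt_def, Fin.val_castSucc]
  split_ifs <;> simp

theorem contains_right {k l n : ℕ} (σ : Equiv.Perm (Fin n)) (i : ℕ) (i' : Fin (n + 1))
    (hi : (i' : ℕ) = min i n) :
    (Ch (· < ·) k (W σ ++ [2 * i]) ∨ Ch (· > ·) l (W σ ++ [2 * i])) ↔
      ContainsPat k l (n + 1) (rightExt σ i') := by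
  have e : W σ ++ [2 * i] = List.ofFn (Fin.snoc (α := fun _ => ℕ)
      (fun j => 2 * (σ j : ℕ) + 1) (2 * i)) := by
    rw [List.ofFn_succ', List.concat_eq_append]
    simp [W]
  have h : ∀ a b, rightExt σ i' a < rightExt σ i' b ↔
      Fin.snoc (α := fun _ => ℕ) (fun j => 2 * (σ j : ℕ) + 1) (2 * i) a <
      Fin.snoc (α := fun _ => ℕ) (fun j => 2 * (σ j : ℕ) + 1) (2 * i) b := by
    intro a b
    unfold rightExt
    induction a using Fin.lastCases with
    | last =>
      induction b using Fin.lastCases with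
      | last => simp
      | cast b =>
        have := (σ b).2
        simp only [Fin.snoc_last, Fin.snoc_castSucc, Fin.lt_def, sa_val]
        split_ifs <;> omega
    | cast a =>
      have := (σ a).2
      induction b using Fin.lastCases with
      | last =>
        simp only [Fin.snoc_last, Fin.snoc_castSucc, Fin.lt_def, sa_val]
        split_ifs <;> omega
      | cast b =>
        have := (σ b).2
        simp only [Fin.snoc_castSucc, Fin.lt_def, sa_val]
        split_ifs <;> omega
  unfold ContainsPat
  rw [e, ch_incr _ _ h, ch_decr _ _ h]

theorem contains_left {k l n : ℕ} (σ : Equiv.Perm (Fin n)) (i : ℕ) (i' : Fin (n + 1))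
    (hi : (i' : ℕ) = min i n) :
    (Ch (· < ·) k (2 * i :: W σ) ∨ Ch (· > ·) l (2 * i :: W σ)) ↔
      ContainsPat k l (n + 1) (leftExt σ i') := by
  have e : 2 * i :: W σ = List.ofFn (Fin.cons (α := fun _ => ℕ) (2 * i)
      (fun j => 2 * (σ j : ℕ) + 1)) := by
    rw [List.ofFn_succ]
    simp [W]
  have h : ∀ a b, leftExt σ i' a < leftExt σ i' b ↔
      Fin.cons (α := fun _ => ℕ) (2 * i) (fun j => 2 * (σ j : ℕ) + 1) a <
      Fin.cons (α := fun _ => ℕ) (2 * i) (fun j => 2 * (σ j : ℕ) + 1) b := by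
    intro a b
    unfold leftExt
    induction a using Fin.cases with
    | zero =>
      induction b using Fin.cases with
      | zero => simp
      | succ b =>
        have := (σ b).2
        simp only [Fin.cons_zero, Fin.cons_succ, Fin.lt_def, sa_val]
        split_ifs <;> omega
    | succ a =>
      have := (σ a).2
      induction b using Fin.cases with
      | zero =>
        simp only [Fin.cons_zero, Fin.cons_succ, Fin.lt_def, sa_val]
        split_ifs <;> omega
      | succ b =>
        have := (σ b).2
        simp only [Fin.cons_succ, Fin.lt_def, sa_val]
        split_ifs <;> omega
  unfold ContainsPat
  rw [e, ch_incr _ _ h, ch_decr _ _ h]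

theorem bicrucial_iff {k l n : ℕ} (σ : Equiv.Perm (Fin n)) :
    Bicrucial k l n σ ↔ RT k l (W σ) := by
  have h : ∀ a b, σ a < σ b ↔ 2 * (σ a : ℕ) + 1 < 2 * (σ b : ℕ) + 1 := by
    intro a b
    rw [Fin.lt_def]; omega
  have h1 : (¬ Ch (· < ·) k (W σ) ∧ ¬ Ch (· > ·) l (W σ)) ↔ AvoidsPat k l n σ := by
    unfold AvoidsPat W
    rw [ch_incr _ _ h, ch_decr _ _ h]
  unfold Bicrucial RightCrucial LeftCrucial RT
  rw [h1]
  constructor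
  · rintro ⟨⟨h1, h2⟩, _, h3⟩
    refine ⟨h1, fun i => ⟨?_, ?_⟩⟩
    · exact (contains_right σ i ⟨min i n, by omega⟩ rfl).2 (h2 _)
    · exact (contains_left σ i ⟨min i n, by omega⟩ rfl).2 (h3 _)
  · rintro ⟨h1, h2⟩
    refine ⟨⟨h1, fun i => ?_⟩, h1, fun i => ?_⟩
    · exact (contains_right σ i i (by omega)).1 (h2 i).1
    · exact (contains_left σ i i (by omega)).1 (h2 i).2

theorem contains_inv {k l n : ℕ} {f g : Fin n → Fin n} (hfg : ∀ x, g (f x) = x)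
    (h : ContainsPat k l n f) : ContainsPat k l n g := by
  rcases h with ⟨F, h1, h2⟩ | ⟨F, h1, h2⟩
  · refine Or.inl ⟨f ∘ F, h2, ?_⟩
    have : g ∘ f ∘ F = F := funext fun x => hfg _
    rw [this]; exact h1
  · refine Or.inr ⟨f ∘ F ∘ Fin.rev, ?_, ?_⟩
    · intro a b hab
      exact h2 (Fin.rev_lt_rev.2 hab)
    · have : g ∘ f ∘ F ∘ Fin.rev = F ∘ Fin.rev := funext fun x => hfg _
      rw [this]
      intro a b hab
      exact h1 (Fin.rev_lt_rev.2 hab)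

theorem top_iff {k l n : ℕ} (σ : Equiv.Perm (Fin n)) (i : Fin (n + 1)) :
    ContainsPat k l (n + 1) (topExt σ i) ↔ ContainsPat k l (n + 1) (rightExt ⇑σ⁻¹ i) := by
  constructor
  · refine contains_inv fun x => ?_
    unfold topExt rightExt
    induction x using Fin.succAboveCases i with
    | x => simp
    | p x => simp
  · refine contains_inv fun x => ?_
    unfold topExt rightExt
    induction x using Fin.lastCases with
    | last => simp
    | cast x => simp

theorem bot_iff {k l n : ℕ} (σ : Equiv.Perm (Fin n)) (i : Fin (n + 1)) :
    ContainsPat k l (n + 1) (botExt σ i) ↔ ContainsPat k l (n + 1) (leftExt ⇑σ⁻¹ i) := by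
  constructor
  · refine contains_inv fun x => ?_
    unfold botExt leftExt
    induction x using Fin.succAboveCases i with
    | x => simp
    | p x => simp
  · refine contains_inv fun x => ?_
    unfold botExt leftExt
    induction x using Fin.cases with
    | zero => simp
    | succ x => simp

theorem avoids_iff {k l n : ℕ} (σ : Fin n → Fin n) :
    AvoidsPat k l n σ ↔ ¬ ContainsPat k l n σ := by
  unfold AvoidsPat ContainsPat
  rw [not_or]

theorem quadro_iff {k l n : ℕ} (σ : Equiv.Perm (Fin n)) :
    Quadrocrucial k l n σ ↔ Good k l n (P σ) ∧ Good k l n (P σ⁻¹) := by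
  have ha : AvoidsPat k l n σ ↔ AvoidsPat k l n ⇑σ⁻¹ := by
    rw [avoids_iff, avoids_iff]
    exact not_congr ⟨contains_inv (by simp), contains_inv (by simp)⟩
  have hb : Quadrocrucial k l n σ ↔ Bicrucial k l n σ ∧ Bicrucial k l n ⇑σ⁻¹ := by
    unfold Quadrocrucial Tricrucial Bicrucial RightCrucial LeftCrucial
    simp only [top_iff, bot_iff, ← ha]
    constructor
    · rintro ⟨⟨⟨⟨a, b⟩, _, c⟩, d⟩, e⟩
      exact ⟨⟨⟨a, b⟩, a, c⟩, ⟨a, d⟩, a, e⟩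
    · rintro ⟨⟨⟨a, b⟩, _, c⟩, ⟨_, d⟩, _, e⟩
      exact ⟨⟨⟨⟨a, b⟩, a, c⟩, d⟩, e⟩
  rw [hb, bicrucial_iff, bicrucial_iff, RT_congr (W_eqv σ), RT_congr (W_eqv σ⁻¹)]
  unfold Good
  have h1 := P_tab σ
  have h2 := P_tab σ⁻¹
  constructor
  · rintro ⟨a, b⟩; exact ⟨⟨h1, a⟩, h2, b⟩
  · rintro ⟨⟨_, a⟩, _, b⟩; exact ⟨a, b⟩

noncomputable def toGP (k l n : ℕ) (σ : {σ : Equiv.Perm (Fin n) // Quadrocrucial k l n ⇑σ}) :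
    GP k l n :=
  ⟨(P σ.1, P σ.1⁻¹), ((quadro_iff σ.1).1 σ.2).1, ((quadro_iff σ.1).1 σ.2).2,
    fun _ hr => P_shape σ.1 hr⟩

theorem toGP_bij (k l n : ℕ) : Function.Bijective (toGP k l n) := by
  constructor
  · rintro ⟨σ, hσ⟩ ⟨τ, hτ⟩ h
    have h' := congrArg Subtype.val h
    exact Subtype.ext (P_inj (congrArg Prod.fst h') (congrArg Prod.snd h'))
  · rintro ⟨⟨T, T'⟩, h1, h2, h3⟩
    obtain ⟨σ, e1, e2⟩ := P_surj h1.1 h2.1 h3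
    refine ⟨⟨σ, (quadro_iff σ).2 ⟨by rw [e1]; exact h1, by rw [e2]; exact h2⟩⟩, ?_⟩
    exact Subtype.ext (Prod.ext e1 e2)

theorem card_GP (k l n : ℕ) :
    Nat.card {σ : Equiv.Perm (Fin n) // Quadrocrucial k l n ⇑σ} = Nat.card (GP k l n) :=
  Nat.card_congr (Equiv.ofBijective _ (toGP_bij k l n))

theorem finite_GP (k l n : ℕ) : Finite (GP k l n) :=
  Finite.of_surjective _ (toGP_bij k l n).2

end QC
namespace QC

def pairFib {A B : Type*} (f : A → B) :
    (Σ i : B, {a : A // f a = i} × {a : A // f a = i}) ≃ {x : A × A // f x.1 = f x.2} where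
  toFun y := ⟨(y.2.1.1, y.2.2.1), y.2.1.2.trans y.2.2.2.symm⟩
  invFun x := ⟨f x.1.2, ⟨x.1.1, x.2⟩, ⟨x.1.2, rfl⟩⟩
  left_inv := by
    rintro ⟨i, ⟨a, ha⟩, ⟨b, rfl⟩⟩
    rfl
  right_inv := by
    rintro ⟨⟨a, b⟩, h⟩
    rfl

theorem card_pair {A : Type*} [Finite A] {N : ℕ} (f : A → Fin N) :
    Nat.card {x : A × A // f x.1 = f x.2} = ∑ i, (Nat.card {a : A // f a = i}) ^ 2 := by
  rw [← Nat.card_congr (pairFib f), Nat.card_sigma]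
  simp only [Nat.card_prod, pow_two]

section
variable {p q n : ℕ}

def shp (q n : ℕ) (T : ℕ → ℕ) : List ℕ := (List.range q).map (fun r => cnt T n (r + 1))

theorem shp_sorted {T : ℕ → ℕ} (h : Latt T) : (shp q n T).Pairwise (· ≥ ·) := by
  unfold shp
  rw [List.pairwise_map]
  refine List.pairwise_lt_range.imp ?_
  intro a b hab
  exact h.anti n (by omega) (by omega)

def toPart (hp : 1 ≤ p) (hq : 1 ≤ q) (T : ℕ → ℕ) (h : Good (p + 1) (q + 1) n T) : n.Partition where
  parts := (shp q n T : Multiset ℕ)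
  parts_pos := by
    intro i hi
    obtain ⟨_, _, h3⟩ := good_facts hp hq h
    unfold shp at hi
    simp only [Multiset.mem_coe, List.mem_map, List.mem_range] at hi
    obtain ⟨r, hr, rfl⟩ := hi
    have := h.1.2.anti n (show 1 ≤ r + 1 by omega) (show r + 1 ≤ q by omega)
    omega
  parts_sum := by
    obtain ⟨_, h2, h3⟩ := good_facts hp hq h
    have := sum_cnt n (tab_le h.1 h2)
    refine Eq.trans ?_ this
    rfl

abbrev PS (p q n : ℕ) : Type := {x : n.Partition //
  Multiset.card x.parts = q + 1 - 1 ∧ (∀ y ∈ x.parts, y ≤ p + 1 - 1) ∧ p + 1 - 1 ∈ x.parts}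

def toPS (hp : 1 ≤ p) (hq : 1 ≤ q) (T : {T : ℕ → ℕ // Good (p + 1) (q + 1) n T}) : PS p q n :=
  ⟨toPart hp hq T.1 T.2, by
    obtain ⟨h1, h2, h3⟩ := good_facts hp hq T.2
    refine ⟨?_, ?_, ?_⟩
    · simp [toPart, shp]
    · intro y hy
      simp only [toPart, shp, Multiset.mem_coe, List.mem_map, List.mem_range] at hy
      obtain ⟨r, hr, rfl⟩ := hy
      have := T.2.1.2.anti n (show 1 ≤ 1 by omega) (show 1 ≤ r + 1 by omega)
      omega
    · simp only [toPart, shp, Multiset.mem_coe, List.mem_map, List.mem_range]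
      exact ⟨0, by omega, by rw [Nat.zero_add, h1]; omega⟩⟩

theorem toPS_eq (hp : 1 ≤ p) (hq : 1 ≤ q) (T T' : {T : ℕ → ℕ // Good (p + 1) (q + 1) n T}) :
    toPS hp hq T = toPS hp hq T' ↔ ∀ r, 1 ≤ r → cnt T.1 n r = cnt T'.1 n r := by
  have e : toPS hp hq T = toPS hp hq T' ↔ shp q n T.1 = shp q n T'.1 := by
    constructor
    · intro h
      have h' : (shp q n T.1 : Multiset ℕ) = (shp q n T'.1 : Multiset ℕ) :=
        congrArg (fun x => x.1.parts) h
      exact (Multiset.coe_eq_coe.1 h').eq_of_pairwise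
        (fun a b _ _ h1 h2 => le_antisymm h2 h1) (shp_sorted T.2.1.2) (shp_sorted T'.2.1.2)
    · intro h
      apply Subtype.ext
      apply Nat.Partition.ext
      exact congrArg (fun l : List ℕ => (l : Multiset ℕ)) h
  rw [e]
  obtain ⟨_, h2, _⟩ := good_facts hp hq T.2
  obtain ⟨_, h2', _⟩ := good_facts hp hq T'.2
  unfold shp
  constructor
  · intro h r hr
    rw [List.map_inj_left] at h
    rcases le_or_gt r q with hrq | hrq
    · have := h (r - 1) (List.mem_range.2 (by omega))
      rwa [show r - 1 + 1 = r by omega] at this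
    · have := T.2.1.2.anti n (show 1 ≤ q + 1 by omega) (show q + 1 ≤ r by omega)
      have := T'.2.1.2.anti n (show 1 ≤ q + 1 by omega) (show q + 1 ≤ r by omega)
      omega
  · intro h
    rw [List.map_inj_left]
    intro r _
    exact h (r + 1) (by omega)

theorem finite_good : Finite {T : ℕ → ℕ // Good (p + 1) (q + 1) n T} := by
  have := finite_GP (p + 1) (q + 1) n
  let f : {T : ℕ → ℕ // Good (p + 1) (q + 1) n T} → GP (p + 1) (q + 1) n :=
    fun T => ⟨(T.1, T.1), T.2, T.2, fun _ _ => rfl⟩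
  refine Finite.of_injective f ?_
  intro a b h
  exact Subtype.ext (congrArg (fun x => x.1.1) h)

def gpEquiv (hp : 1 ≤ p) (hq : 1 ≤ q) {N : ℕ} (e : PS p q n ≃ Fin N) :
    GP (p + 1) (q + 1) n ≃
    {x : {T : ℕ → ℕ // Good (p + 1) (q + 1) n T} × {T : ℕ → ℕ // Good (p + 1) (q + 1) n T} //
      e (toPS hp hq x.1) = e (toPS hp hq x.2)} where
  toFun x := ⟨(⟨x.1.1, x.2.1⟩, ⟨x.1.2, x.2.2.1⟩),
    congrArg e ((toPS_eq hp hq _ _).2 x.2.2.2)⟩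
  invFun x := ⟨(x.1.1.1, x.1.2.1), x.1.1.2, x.1.2.2, (toPS_eq hp hq _ _).1 (e.injective x.2)⟩
  left_inv := fun _ => rfl
  right_inv := fun _ => rfl

theorem sum_squares (hp : 1 ≤ p) (hq : 1 ≤ q) (n : ℕ) :
    ∃ m : Fin (Nat.card (PS p q n)) → ℕ,
      Nat.card {σ : Equiv.Perm (Fin n) // Quadrocrucial (p + 1) (q + 1) n ⇑σ} =
        ∑ i, (m i) ^ 2 := by
  have := finite_good (p := p) (q := q) (n := n)
  rw [card_GP, Nat.card_congr (gpEquiv hp hq (Finite.equivFin (PS p q n)))]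
  exact ⟨_, card_pair (fun T => Finite.equivFin (PS p q n) (toPS hp hq T))⟩

end

end QC
/-- monotonicity and sum-of-squares for quadrocrucial permutations: for
`k ≥ l ≥ 3`, the number of `(k,l)`-quadrocrucial permutations of length `n` is strictly
increasing for `k+2l-5 ≤ n < (k-1)(l-1)`; moreover, for every `n` the number of
`(k,l)`-quadrocrucial permutations of length `n` is a sum `m₁² + ⋯ + m_t²` of `t` squares
of natural numbers, where `t` is the number of partitions of `n` into exactly `l-1` parts
whose largest part equals `k-1`. -/
theorem quadrocrucial_count_mono_and_sum_of_squares (k l : ℕ) (hl : 3 ≤ l) (hkl : l ≤ k) :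
    (∀ n : ℕ, k + 2 * l - 5 ≤ n → n < (k - 1) * (l - 1) →
      Nat.card {σ : Equiv.Perm (Fin n) // Quadrocrucial k l n ⇑σ} <
        Nat.card {σ : Equiv.Perm (Fin (n + 1)) // Quadrocrucial k l (n + 1) ⇑σ}) ∧
    (∀ n : ℕ,
      ∃ m : Fin (Nat.card {p : n.Partition //
          Multiset.card p.parts = l - 1 ∧ (∀ x ∈ p.parts, x ≤ k - 1) ∧ k - 1 ∈ p.parts}) → ℕ,
        Nat.card {σ : Equiv.Perm (Fin n) // Quadrocrucial k l n ⇑σ} =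
          ∑ i, (m i) ^ 2) := by
  constructor
  · intro n h1 h2
    obtain ⟨a, rfl⟩ := Nat.exists_eq_add_of_le' (show 3 ≤ k by omega)
    obtain ⟨q, rfl⟩ := Nat.exists_eq_add_of_le' (show 1 ≤ l by omega)
    have := QC.finite_GP (a + 3) (q + 1) (n + 1)
    rw [QC.card_GP, QC.card_GP]
    exact QC.gp_lt (by omega) (by omega) h2
  · intro n
    obtain ⟨p, rfl⟩ := Nat.exists_eq_add_of_le' (show 1 ≤ k by omega)
    obtain ⟨q, rfl⟩ := Nat.exists_eq_add_of_le' (show 1 ≤ l by omega)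
    exact QC.sum_squares (by omega) (by omega) n
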